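/- For the Lorenz five-mode system and any real b, the candidate slow manifold x = X(u, v, w) := −b u v, z = Z(u, v, w) := b(u² − v²) w satisfies the invariance equations to the following orders: with slow vector field S(u, v, w) = (−v w + b v Z, u w − b u Z, −u v), one has the exact identities ∇X · S + Z = b³(u² − v²)² w and ∇Z · S − (X + b u v) = −b u v (u² − v²) − 4 b u v w² + 4 b³ u v (u² − v²) w²; consequently the first residual is O(‖(u, v, w)‖⁵) and the second is O(‖(u, v, w)‖⁴) as (u, v, w) → 0, so x = −b u v + O(s⁴) and z = b(u² − v²) w + O(s⁵) where s = ‖(u, v, w)‖. -/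

import Mathlib

open Asymptotics Topology Filter

namespace LorenzFiveMode

noncomputable section

/-- The part of degree `2` of the slow expansion of `x`, as a polynomial in
`A = u² - v²`, `B = 2 u v` and `w`. -/
def x2 (b A B w : ℝ) : ℝ :=
  (-1 / 2 * b) * (B)

/-- The image of `x2` under `A ∂/∂B - B ∂/∂A`. -/
def x2Rot (b A B w : ℝ) : ℝ :=
  (-1 / 2 * b) * (A)

/-- The derivative of `x2` with respect to `w`. -/
def x2W (b A B w : ℝ) : ℝ :=
  0 * b

/-- The part of degree `3` of the slow expansion of `z`, as a polynomial in
`A = u² - v²`, `B = 2 u v` and `w`. -/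
def z3 (b A B w : ℝ) : ℝ :=
  (b) * (A * w)

/-- The image of `z3` under `A ∂/∂B - B ∂/∂A`. -/
def z3Rot (b A B w : ℝ) : ℝ :=
  (-b) * (B * w)

/-- The derivative of `z3` with respect to `w`. -/
def z3W (b A B w : ℝ) : ℝ :=
  (b) * (A)

/-- The part of degree `4` of the slow expansion of `x`, as a polynomial in
`A = u² - v²`, `B = 2 u v` and `w`. -/
def x4 (b A B w : ℝ) : ℝ :=
  (-1 / 2 * b) * (A * B) + (-2 * b) * (B * w^2)

/-- The image of `x4` under `A ∂/∂B - B ∂/∂A`. -/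
def x4Rot (b A B w : ℝ) : ℝ :=
  (-2 * b) * (A * w^2) + (-1 / 2 * b) * (A^2) + (1 / 2 * b) * (B^2)

/-- The derivative of `x4` with respect to `w`. -/
def x4W (b A B w : ℝ) : ℝ :=
  (-4 * b) * (B * w)

/-- The part of degree `5` of the slow expansion of `z`, as a polynomial in
`A = u² - v²`, `B = 2 u v` and `w`. -/
def z5 (b A B w : ℝ) : ℝ :=
  (4 * b) * (A * w^3) + (b - b^3) * (A^2 * w) + (-3 * b) * (B^2 * w)

/-- The image of `z5` under `A ∂/∂B - B ∂/∂A`. -/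
def z5Rot (b A B w : ℝ) : ℝ :=
  (-8 * b + 2 * b^3) * (A * B * w) + (-4 * b) * (B * w^3)

/-- The derivative of `z5` with respect to `w`. -/
def z5W (b A B w : ℝ) : ℝ :=
  (12 * b) * (A * w^2) + (b - b^3) * (A^2) + (-3 * b) * (B^2)

/-- The part of degree `6` of the slow expansion of `x`, as a polynomial in
`A = u² - v²`, `B = 2 u v` and `w`. -/
def x6 (b A B w : ℝ) : ℝ :=
  (-22 * b + 6 * b^3) * (A * B * w^2) + (-1 / 2 * b + 1 / 2 * b^3) * (A^2 * B)
    + (-8 * b) * (B * w^4) + (3 / 2 * b) * (B^3)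

/-- The image of `x6` under `A ∂/∂B - B ∂/∂A`. -/
def x6Rot (b A B w : ℝ) : ℝ :=
  (11 / 2 * b - b^3) * (A * B^2) + (-8 * b) * (A * w^4) + (-22 * b + 6 * b^3) * (A^2 * w^2)
    + (-1 / 2 * b + 1 / 2 * b^3) * (A^3) + (22 * b - 6 * b^3) * (B^2 * w^2)

/-- The derivative of `x6` with respect to `w`. -/
def x6W (b A B w : ℝ) : ℝ :=
  (-44 * b + 12 * b^3) * (A * B * w) + (-32 * b) * (B * w^3)

/-- The part of degree `7` of the slow expansion of `z`, as a polynomial in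
`A = u² - v²`, `B = 2 u v` and `w`. -/
def z7 (b A B w : ℝ) : ℝ :=
  (-33 * b + 12 * b^3) * (A * B^2 * w) + (16 * b) * (A * w^5)
    + (44 * b - 20 * b^3) * (A^2 * w^3) + (b - 3 * b^3 + b^5) * (A^3 * w)
    + (-60 * b + 12 * b^3) * (B^2 * w^3)

/-- The image of `z7` under `A ∂/∂B - B ∂/∂A`. -/
def z7Rot (b A B w : ℝ) : ℝ :=
  (-208 * b + 64 * b^3) * (A * B * w^3) + (-69 * b + 33 * b^3 - 3 * b^5) * (A^2 * B * w)
    + (-16 * b) * (B * w^5) + (33 * b - 12 * b^3) * (B^3 * w)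

/-- The derivative of `z7` with respect to `w`. -/
def z7W (b A B w : ℝ) : ℝ :=
  (-33 * b + 12 * b^3) * (A * B^2) + (80 * b) * (A * w^4) + (132 * b - 60 * b^3) * (A^2 * w^2)
    + (b - 3 * b^3 + b^5) * (A^3) + (-180 * b + 36 * b^3) * (B^2 * w^2)

/-- The part of degree `8` of the slow expansion of `x`, as a polynomial in
`A = u² - v²`, `B = 2 u v` and `w`. -/
def x8 (b A B w : ℝ) : ℝ :=
  (-456 * b + 144 * b^3) * (A * B * w^4) + (33 / 2 * b - 6 * b^3) * (A * B^3)
    + (-204 * b + 114 * b^3 - 12 * b^5) * (A^2 * B * w^2)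
    + (-1 / 2 * b + 3 / 2 * b^3 - 1 / 2 * b^5) * (A^3 * B) + (-32 * b) * (B * w^6)
    + (156 * b - 48 * b^3) * (B^3 * w^2)

/-- The image of `x8` under `A ∂/∂B - B ∂/∂A`. -/
def x8Rot (b A B w : ℝ) : ℝ :=
  (876 * b - 372 * b^3 + 24 * b^5) * (A * B^2 * w^2) + (-32 * b) * (A * w^6)
    + (51 * b - 45 / 2 * b^3 + 3 / 2 * b^5) * (A^2 * B^2) + (-456 * b + 144 * b^3) * (A^2 * w^4)
    + (-204 * b + 114 * b^3 - 12 * b^5) * (A^3 * w^2)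
    + (-1 / 2 * b + 3 / 2 * b^3 - 1 / 2 * b^5) * (A^4) + (456 * b - 144 * b^3) * (B^2 * w^4)
    + (-33 / 2 * b + 6 * b^3) * (B^4)

/-- The derivative of `x8` with respect to `w`. -/
def x8W (b A B w : ℝ) : ℝ :=
  (-1824 * b + 576 * b^3) * (A * B * w^3) + (-408 * b + 228 * b^3 - 24 * b^5) * (A^2 * B * w)
    + (-192 * b) * (B * w^5) + (312 * b - 96 * b^3) * (B^3 * w)

end

section

variable {b t : ℝ} {A B w : ℝ → ℝ}

theorem hasDerivAt_x2 {ν : ℝ} (hA : HasDerivAt A (-(2 * ν * B t)) t)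
    (hB : HasDerivAt B (2 * ν * A t) t) (hw : HasDerivAt w (-(B t / 2)) t) :
    HasDerivAt (fun t => x2 b (A t) (B t) (w t))
      (2 * ν * x2Rot b (A t) (B t) (w t) - B t / 2 * x2W b (A t) (B t) (w t)) t := by
  refine HasDerivAt.congr_deriv
    (hB.const_mul _) ?_
  simp only [x2Rot, x2W]
  ring

theorem hasDerivAt_z3 {ν : ℝ} (hA : HasDerivAt A (-(2 * ν * B t)) t)
    (hB : HasDerivAt B (2 * ν * A t) t) (hw : HasDerivAt w (-(B t / 2)) t) :
    HasDerivAt (fun t => z3 b (A t) (B t) (w t))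
      (2 * ν * z3Rot b (A t) (B t) (w t) - B t / 2 * z3W b (A t) (B t) (w t)) t := by
  refine HasDerivAt.congr_deriv
    ((hA.fun_mul hw).const_mul _) ?_
  simp only [z3Rot, z3W]
  ring

theorem hasDerivAt_x4 {ν : ℝ} (hA : HasDerivAt A (-(2 * ν * B t)) t)
    (hB : HasDerivAt B (2 * ν * A t) t) (hw : HasDerivAt w (-(B t / 2)) t) :
    HasDerivAt (fun t => x4 b (A t) (B t) (w t))
      (2 * ν * x4Rot b (A t) (B t) (w t) - B t / 2 * x4W b (A t) (B t) (w t)) t := by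
  refine HasDerivAt.congr_deriv
    (((hA.fun_mul hB).const_mul _).fun_add ((hB.fun_mul (hw.fun_pow 2)).const_mul _)) ?_
  simp only [x4Rot, x4W]
  ring

theorem hasDerivAt_z5 {ν : ℝ} (hA : HasDerivAt A (-(2 * ν * B t)) t)
    (hB : HasDerivAt B (2 * ν * A t) t) (hw : HasDerivAt w (-(B t / 2)) t) :
    HasDerivAt (fun t => z5 b (A t) (B t) (w t))
      (2 * ν * z5Rot b (A t) (B t) (w t) - B t / 2 * z5W b (A t) (B t) (w t)) t := by
  refine HasDerivAt.congr_deriv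
    ((((hA.fun_mul (hw.fun_pow 3)).const_mul _).fun_add (((hA.fun_pow 2).fun_mul hw).const_mul
    _)).fun_add (((hB.fun_pow 2).fun_mul hw).const_mul _)) ?_
  simp only [z5Rot, z5W]
  ring

theorem hasDerivAt_x6 {ν : ℝ} (hA : HasDerivAt A (-(2 * ν * B t)) t)
    (hB : HasDerivAt B (2 * ν * A t) t) (hw : HasDerivAt w (-(B t / 2)) t) :
    HasDerivAt (fun t => x6 b (A t) (B t) (w t))
      (2 * ν * x6Rot b (A t) (B t) (w t) - B t / 2 * x6W b (A t) (B t) (w t)) t := by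
  refine HasDerivAt.congr_deriv
    ((((((hA.fun_mul hB).fun_mul (hw.fun_pow 2)).const_mul _).fun_add (((hA.fun_pow 2).fun_mul
    hB).const_mul _)).fun_add ((hB.fun_mul (hw.fun_pow 4)).const_mul _)).fun_add ((hB.fun_pow
    3).const_mul _)) ?_
  simp only [x6Rot, x6W]
  ring

theorem hasDerivAt_z7 {ν : ℝ} (hA : HasDerivAt A (-(2 * ν * B t)) t)
    (hB : HasDerivAt B (2 * ν * A t) t) (hw : HasDerivAt w (-(B t / 2)) t) :
    HasDerivAt (fun t => z7 b (A t) (B t) (w t))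
      (2 * ν * z7Rot b (A t) (B t) (w t) - B t / 2 * z7W b (A t) (B t) (w t)) t := by
  refine HasDerivAt.congr_deriv
    (((((((hA.fun_mul (hB.fun_pow 2)).fun_mul hw).const_mul _).fun_add ((hA.fun_mul (hw.fun_pow
    5)).const_mul _)).fun_add (((hA.fun_pow 2).fun_mul (hw.fun_pow 3)).const_mul _)).fun_add
    (((hA.fun_pow 3).fun_mul hw).const_mul _)).fun_add (((hB.fun_pow 2).fun_mul (hw.fun_pow
    3)).const_mul _)) ?_
  simp only [z7Rot, z7W]
  ring

theorem hasDerivAt_x8 {ν : ℝ} (hA : HasDerivAt A (-(2 * ν * B t)) t)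
    (hB : HasDerivAt B (2 * ν * A t) t) (hw : HasDerivAt w (-(B t / 2)) t) :
    HasDerivAt (fun t => x8 b (A t) (B t) (w t))
      (2 * ν * x8Rot b (A t) (B t) (w t) - B t / 2 * x8W b (A t) (B t) (w t)) t := by
  refine HasDerivAt.congr_deriv
    ((((((((hA.fun_mul hB).fun_mul (hw.fun_pow 4)).const_mul _).fun_add ((hA.fun_mul (hB.fun_pow
    3)).const_mul _)).fun_add ((((hA.fun_pow 2).fun_mul hB).fun_mul (hw.fun_pow 2)).const_mul
    _)).fun_add (((hA.fun_pow 3).fun_mul hB).const_mul _)).fun_add ((hB.fun_mul (hw.fun_pow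
    6)).const_mul _)).fun_add (((hB.fun_pow 3).fun_mul (hw.fun_pow 2)).const_mul _)) ?_
  simp only [x8Rot, x8W]
  ring

end


noncomputable section

/-- The slow expansion of `x` through degree eight. -/
def slowX (b A B w : ℝ) : ℝ := x2 b A B w + x4 b A B w + x6 b A B w + x8 b A B w

/-- The slow expansion of `z` through degree seven. -/
def slowZ (b A B w : ℝ) : ℝ := z3 b A B w + z5 b A B w + z7 b A B w

/-- The image of `slowX` under `A ∂/∂B - B ∂/∂A`. -/
def slowXRot (b A B w : ℝ) : ℝ := x2Rot b A B w + x4Rot b A B w + x6Rot b A B w + x8Rot b A B w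

/-- The image of `slowZ` under `A ∂/∂B - B ∂/∂A`. -/
def slowZRot (b A B w : ℝ) : ℝ := z3Rot b A B w + z5Rot b A B w + z7Rot b A B w

/-- The derivative of `slowX` with respect to `w`. -/
def slowXW (b A B w : ℝ) : ℝ := x2W b A B w + x4W b A B w + x6W b A B w + x8W b A B w

/-- The derivative of `slowZ` with respect to `w`. -/
def slowZW (b A B w : ℝ) : ℝ := z3W b A B w + z5W b A B w + z7W b A B w

/-- The residual of the slow expansion in the equation for `x`. -/
def resX (b A B w : ℝ) : ℝ :=
  2 * (w - b * slowZ b A B w) * slowXRot b A B w - B / 2 * slowXW b A B w + slowZ b A B w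

/-- The residual of the slow expansion in the equation for `z`. -/
def resZ (b A B w : ℝ) : ℝ :=
  2 * (w - b * slowZ b A B w) * slowZRot b A B w - B / 2 * slowZW b A B w
    - (slowX b A B w + b * B / 2)

def slowZTail (b s A B w : ℝ) : ℝ := z5 b A B w + s^2 * z7 b A B w

def slowXRotTail (b s A B w : ℝ) : ℝ := x4Rot b A B w + s^2 * x6Rot b A B w + s^4 * x8Rot b A B w

def slowZRotTail (b s A B w : ℝ) : ℝ := z5Rot b A B w + s^2 * z7Rot b A B w

def resXTail (b s A B w : ℝ) : ℝ :=
  2 * w * x8Rot b A B w - B / 2 * x8W b A B w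
    - 2 * b * (z7 b A B w * x2Rot b A B w
      + (z5 b A B w + s^2 * z7 b A B w) * x4Rot b A B w
      + (z3 b A B w + s^2 * z5 b A B w + s^4 * z7 b A B w) * x6Rot b A B w
      + s^2 * (z3 b A B w + s^2 * z5 b A B w + s^4 * z7 b A B w) * x8Rot b A B w)

def resZTail (b s A B w : ℝ) : ℝ :=
  -2 * b * (z7 b A B w * z3Rot b A B w + (z5 b A B w + s^2 * z7 b A B w) * z5Rot b A B w
    + (z3 b A B w + s^2 * z5 b A B w + s^4 * z7 b A B w) * z7Rot b A B w)

theorem slowZ_scale (b s A B w : ℝ) :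
    slowZ b (s^2 * A) (s^2 * B) (s * w) = s^3 * (b * w * A) + s^5 * slowZTail b s A B w := by
  simp only [slowZ, slowZTail, z3, z5, z7]
  ring

theorem slowXRot_scale (b s A B w : ℝ) :
    slowXRot b (s^2 * A) (s^2 * B) (s * w)
      = s^2 * (-1 / 2 * b * A) + s^4 * slowXRotTail b s A B w := by
  simp only [slowXRot, slowXRotTail, x2Rot, x4Rot, x6Rot, x8Rot]
  ring

theorem slowZRot_scale (b s A B w : ℝ) :
    slowZRot b (s^2 * A) (s^2 * B) (s * w)
      = s^3 * (-b * w * B) + s^5 * slowZRotTail b s A B w := by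
  simp only [slowZRot, slowZRotTail, z3Rot, z5Rot, z7Rot]
  ring

theorem resX_scale (b s A B w : ℝ) :
    resX b (s^2 * A) (s^2 * B) (s * w) = s^9 * resXTail b s A B w := by
  simp only [resX, resXTail, slowZ, slowXRot, slowXW, z3, z5, z7, x2Rot, x4Rot, x6Rot, x8Rot,
    x2W, x4W, x6W, x8W]
  ring

theorem resZ_scale (b s A B w : ℝ) :
    resZ b (s^2 * A) (s^2 * B) (s * w) = s^10 * resZTail b s A B w := by
  simp only [resZ, resZTail, slowZ, slowX, slowZRot, slowZW, z3, z5, z7, z3Rot, z5Rot, z7Rot,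
    z3W, z5W, z7W, x2, x4, x6, x8]
  ring

/-- The rotation rate of the `(u, v)` plane, when `z` deviates from `slowZ` by `z`. -/
def rate (b A B w z : ℝ) : ℝ := w - b * (slowZ b A B w + z)

/-- The velocity of the deviation of `x` from `slowX`. -/
def velX (b A B w z : ℝ) : ℝ := -z - resX b A B w + 2 * b * z * slowXRot b A B w

/-- The velocity of the deviation of `z` from `slowZ`. -/
def velZ (b A B w x z : ℝ) : ℝ := x - resZ b A B w + 2 * b * z * slowZRot b A B w

/-- The angle by which the `(u, v)` plane is rotated in the normal form. -/
def psi (b A B x : ℝ) : ℝ := (1 + (1 - b^2 / 2) * A) * x - b * B / 4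

def velPsi (b A B w x z : ℝ) : ℝ :=
  (1 - b^2 / 2) * (-(2 * rate b A B w z * B)) * x + (1 + (1 - b^2 / 2) * A) * velX b A B w z
    - b * (2 * rate b A B w z * A) / 4

/-- The normal form variable replacing `w`. -/
def nfW (b A B w x z : ℝ) : ℝ := w + b * A * z - 2 * b * w * B * x

def velNfW (b A B w x z : ℝ) : ℝ :=
  -(B / 2) + (b * (-(2 * rate b A B w z * B)) * z + b * A * velZ b A B w x z)
    - (2 * b * (-(B / 2) * B + w * (2 * rate b A B w z * A)) * x
      + 2 * b * w * B * velX b A B w z)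

/-- The defect of the rotation rate in the normal form. -/
def theta (b A B w x z : ℝ) : ℝ :=
  (1 - b^2 / 2 * A) * nfW b A B w x z - (rate b A B w z - b * velPsi b A B w x z)

/-- The first part of the defect of the equation for `nfW`. -/
def defectW (b A B w x z : ℝ) : ℝ :=
  velNfW b A B w x z + (1 - b^2 / 2 * A) * (B / 2 - b * psi b A B x * A)

/-- The first normal form variable of the fast oscillation. -/
def nfX (b A B w x z : ℝ) : ℝ :=
  (1 - 3 / 4 * (b^2 * A)) * x - 3 / 2 * (b^2 * w * B) * z

/-- The second normal form variable of the fast oscillation. -/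
def nfZ (b A z : ℝ) : ℝ := (1 - 1 / 4 * (b^2 * A)) * z

/-- The frequency of the fast oscillation. -/
def freq (b A : ℝ) : ℝ := 1 + b^2 / 2 * A

def velNfX (b A B w x z : ℝ) : ℝ :=
  -(3 / 4 * (b^2 * (-(2 * rate b A B w z * B)))) * x
    + (1 - 3 / 4 * (b^2 * A)) * velX b A B w z
    - (3 / 2 * (b^2 * (-(B / 2) * B + w * (2 * rate b A B w z * A))) * z
      + 3 / 2 * (b^2 * w * B) * velZ b A B w x z)

def velNfZ (b A B w x z : ℝ) : ℝ :=
  -(1 / 4 * (b^2 * (-(2 * rate b A B w z * B)))) * z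
    + (1 - 1 / 4 * (b^2 * A)) * velZ b A B w x z

def defectX (b A B w x z : ℝ) : ℝ := velNfX b A B w x z + freq b A * nfZ b A z

def defectZ (b A B w x z : ℝ) : ℝ := velNfZ b A B w x z - freq b A * nfX b A B w x z

def thetaCore (b s A B w f g ζ ξ η ρ₁ ρ₂ : ℝ) : ℝ :=
  3 * A * B * b^3 * f * s^2 * w - A * B * b^5 * f * s^2 * w - A * b * ρ₁ * s^6 + 2 * A * b^2 *
    g * s^3 * ξ + 1 / 2 * A * b^3 * ρ₁ * s^6 + 1 / 2 * A * b^3 * s^2 * ζ - A * b^4 * g * s^3 *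
    ξ - 3 / 2 * A^2 * b^3 * g * s + 1 / 2 * A^2 * b^4 * w + 1 / 2 * A^2 * b^5 * g * s - 4 * B
    * b * f * w + 2 * B * b^2 * f * g * s + 2 * B * b^2 * f * s^4 * ζ + B * b^3 * f * w - B *
    b^4 * f * g * s - B * b^4 * f * s^4 * ζ - b * ρ₁ * s^4 + b * ζ + 2 * b^2 * g * s * ξ

theorem theta_scale (b s A B w f g : ℝ) :
    theta b (s^2 * A) (s^2 * B) (s * w) (s^2 * f) (s^2 * g)
      = s^5 * thetaCore b s A B w f g (slowZTail b s A B w) (slowXRotTail b s A B w)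
        (slowZRotTail b s A B w) (resXTail b s A B w) (resZTail b s A B w) := by
  simp only [theta, thetaCore, nfW, velPsi, velX, rate,
    slowZ_scale, slowXRot_scale, resX_scale]
  ring

def defectWCore (b s A B w f g ζ ξ η ρ₁ ρ₂ : ℝ) : ℝ :=
  2 * A * B * b^3 * g * s * w - 4 * A * b * f * w^2 - A * b * ρ₂ * s^6 + 4 * A * b^2 * f * g *
    s * w + 4 * A * b^2 * f * s^4 * w * ζ + 2 * A * b^2 * g * s^3 * η - 1 / 8 * A^2 * B * b^4
    - A^2 * b * f + A^2 * b^3 * f + 4 * A^2 * b^3 * f * s^2 * w^2 + 1 / 2 * A^3 * b^3 * f *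
    s^2 - 1 / 4 * A^3 * b^5 * f * s^2 + 2 * B * b * ρ₁ * s^6 * w - 4 * B * b^2 * g * s^3 * w *
    ξ + 2 * B * b^2 * g * s^3 * ζ + 2 * B * b^2 * g^2 + B^2 * b * f

theorem defectW_scale (b s A B w f g : ℝ) :
    defectW b (s^2 * A) (s^2 * B) (s * w) (s^2 * f) (s^2 * g)
      = s^6 * defectWCore b s A B w f g (slowZTail b s A B w) (slowXRotTail b s A B w)
        (slowZRotTail b s A B w) (resXTail b s A B w) (resZTail b s A B w) := by
  simp only [defectW, defectWCore, velNfW, psi, velX, velZ, rate,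
    slowZ_scale, slowXRot_scale, slowZRot_scale, resX_scale, resZ_scale]
  ring

def defectXCore (b s A B w f g ζ ξ η ρ₁ ρ₂ : ℝ) : ℝ :=
  -3 / 2 * A * B * b^4 * f * s * w - 3 * A * b^2 * g * w^2 + 3 / 4 * A * b^2 * ρ₁ * s^5 - 3 /
    2 * A * b^3 * g * s^2 * ξ + 3 * A * b^3 * g * s^4 * w * ζ + 3 * A * b^3 * g^2 * s * w + 5
    / 8 * A^2 * b^4 * g + 3 * A^2 * b^4 * g * s^2 * w^2 + 3 / 2 * B * b^2 * ρ₂ * s^7 * w - 3 /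
    2 * B * b^3 * f * g - 3 / 2 * B * b^3 * f * s^3 * ζ - 3 * B * b^3 * g * s^4 * w * η + 3 /
    4 * B^2 * b^2 * g + 3 * B^2 * b^4 * g * s^2 * w^2 + 2 * b * g * ξ - ρ₁ * s^3

theorem defectX_scale (b s A B w f g : ℝ) :
    defectX b (s^2 * A) (s^2 * B) (s * w) (s^2 * f) (s^2 * g)
      = s^6 * defectXCore b s A B w f g (slowZTail b s A B w) (slowXRotTail b s A B w)
        (slowZRotTail b s A B w) (resXTail b s A B w) (resZTail b s A B w) := by
  simp only [defectX, defectXCore, velNfX, nfZ, freq, velX, velZ, rate,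
    slowZ_scale, slowXRot_scale, slowZRot_scale, resX_scale, resZ_scale]
  ring

def defectZCore (b s A B w f g ζ ξ η ρ₁ ρ₂ : ℝ) : ℝ :=
  3 / 4 * A * B * b^4 * g * s * w + 1 / 4 * A * b^2 * ρ₂ * s^6 - 1 / 2 * A * b^3 * g * s^3 * η
    + 3 / 8 * A^2 * b^4 * f - 1 / 2 * B * b^3 * g * s^3 * ζ - 1 / 2 * B * b^3 * g^2 + 2 * b *
    g * s * η - ρ₂ * s^4

theorem defectZ_scale (b s A B w f g : ℝ) :
    defectZ b (s^2 * A) (s^2 * B) (s * w) (s^2 * f) (s^2 * g)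
      = s^6 * defectZCore b s A B w f g (slowZTail b s A B w) (slowXRotTail b s A B w)
        (slowZRotTail b s A B w) (resXTail b s A B w) (resZTail b s A B w) := by
  simp only [defectZ, defectZCore, velNfZ, nfX, freq, velZ, rate,
    slowZ_scale, slowZRot_scale, resZ_scale]
  ring

def velPsiCore (b s A B w f g ζ ξ η ρ₁ ρ₂ : ℝ) : ℝ :=
  2 * A * B * b^2 * f * s^6 * w - A * B * b^4 * f * s^6 * w + 2 * A * b * g * s^7 * ξ - 1 / 2
    * A * b * s^2 * w + 1 / 2 * A * b^2 * ρ₁ * s^10 + 1 / 2 * A * b^2 * s^6 * ζ - A * b^3 * g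
    * s^7 * ξ - A * g * s^3 - A * ρ₁ * s^10 - A^2 * b^2 * g * s^5 + 1 / 2 * A^2 * b^3 * s^4 *
    w + 1 / 2 * A^2 * b^4 * g * s^5 + 2 * B * b * f * g * s^5 + 2 * B * b * f * s^8 * ζ + B *
    b^2 * f * s^4 * w - B * b^3 * f * g * s^5 - B * b^3 * f * s^8 * ζ - 2 * B * f * s^4 * w +
    2 * b * g * s^5 * ξ - g * s - ρ₁ * s^8

theorem velPsi_scale (b s A B w f g : ℝ) :
    velPsi b (s^2 * A) (s^2 * B) (s * w) (s^2 * f) (s^2 * g)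
      = s * velPsiCore b s A B w f g (slowZTail b s A B w) (slowXRotTail b s A B w)
        (slowZRotTail b s A B w) (resXTail b s A B w) (resZTail b s A B w) := by
  simp only [velPsi, velPsiCore, velX, rate,
    slowZ_scale, slowXRot_scale, resX_scale]
  ring

end


/-- The slow variables `u, v, w` followed by the deviations of `x, z` from the slow expansion. -/
abbrev State : Type := ℝ × ℝ × ℝ × ℝ × ℝ

/-- The anisotropic dilation of the state space. -/
def scale (s : ℝ) (q : State) : State :=
  (s * q.1, s * q.2.1, s * q.2.2.1, s^2 * q.2.2.2.1, s^2 * q.2.2.2.2)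

/-- `Q` vanishes to weighted order `n` at the origin, in a differentiable way. -/
def HasWeight (n : ℕ) (Q : State → ℝ) : Prop :=
  ∃ P : ℝ × State → ℝ, ContDiff ℝ 1 P ∧ ∀ s q, Q (scale s q) = s^n * P (s, q)

namespace HasWeight

theorem add {n : ℕ} {Q R : State → ℝ} (hQ : HasWeight n Q) (hR : HasWeight n R) :
    HasWeight n (fun q => Q q + R q) := by
  obtain ⟨P, hP, hQP⟩ := hQ
  obtain ⟨P', hP', hRP⟩ := hR
  exact ⟨fun y => P y + P' y, hP.add hP', fun s q => by simp only [hQP, hRP]; ring⟩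

theorem mul {m n : ℕ} {Q R : State → ℝ} (hQ : HasWeight m Q) (hR : HasWeight n R) :
    HasWeight (m + n) (fun q => Q q * R q) := by
  obtain ⟨P, hP, hQP⟩ := hQ
  obtain ⟨P', hP', hRP⟩ := hR
  exact ⟨fun y => P y * P' y, hP.mul hP', fun s q => by simp only [hQP, hRP]; ring⟩

theorem const_mul {n : ℕ} {Q : State → ℝ} (c : ℝ) (hQ : HasWeight n Q) :
    HasWeight n (fun q => c * Q q) := by
  obtain ⟨P, hP, hQP⟩ := hQ
  exact ⟨fun y => c * P y, contDiff_const.mul hP, fun s q => by simp only [hQP]; ring⟩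

theorem mono {m n : ℕ} {Q : State → ℝ} (hQ : HasWeight n Q) (h : m ≤ n) : HasWeight m Q := by
  obtain ⟨P, hP, hQP⟩ := hQ
  refine ⟨fun y => y.1^(n - m) * P y, by fun_prop, fun s q => ?_⟩
  rw [hQP, ← mul_assoc, ← pow_add, Nat.add_sub_cancel' h]

theorem congr {n : ℕ} {Q R : State → ℝ} (hQ : HasWeight n Q) (h : ∀ q, R q = Q q) :
    HasWeight n R := by
  rwa [show R = Q from funext h]

end HasWeight

section

variable (b : ℝ) (q : State)

/-- The quadratic `u² - v²`. -/
def qA : ℝ := q.1^2 - q.2.1^2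

/-- The quadratic `2 u v`. -/
def qB : ℝ := 2 * q.1 * q.2.1

/-- A function of `A, B, w, x, z` as a function of the state. -/
def lift (F : ℝ → ℝ → ℝ → ℝ → ℝ → ℝ) : ℝ :=
  F (qA q) (qB q) q.2.2.1 q.2.2.2.1 q.2.2.2.2

/-- The equations of motion in terms of the deviations from the slow expansion. -/
noncomputable def field : State :=
  let ν := rate b (qA q) (qB q) q.2.2.1 q.2.2.2.2
  (-(ν * q.2.1), ν * q.1, -(q.1 * q.2.1), velX b (qA q) (qB q) q.2.2.1 q.2.2.2.2,
    velZ b (qA q) (qB q) q.2.2.1 q.2.2.2.1 q.2.2.2.2)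

noncomputable def qPsi : ℝ := psi b (qA q) (qB q) q.2.2.2.1

/-- The normal form variable replacing `u`. -/
noncomputable def nfU : ℝ := q.1 + b * qPsi b q * q.2.1 - b^2 / 2 * qPsi b q^2 * q.1

/-- The normal form variable replacing `v`. -/
noncomputable def nfV : ℝ := q.2.1 - b * qPsi b q * q.1 - b^2 / 2 * qPsi b q^2 * q.2.1

noncomputable def nfWq : ℝ := lift q (nfW b)

noncomputable def nfXq : ℝ := lift q (nfX b)

noncomputable def nfZq : ℝ := nfZ b (qA q) q.2.2.2.2

/-- The common factor of the normal form of the slow equations. -/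
noncomputable def factor : ℝ := 1 - b^2 / 2 * qA q

noncomputable def defU : ℝ :=
  lift q (theta b) * nfV b q + b^3 / 2 * (qPsi b q * qPsi b q * (lift q (velPsi b) * q.2.1))

noncomputable def defV : ℝ :=
  -1 * (lift q (theta b) * nfU b q)
    + -(b^3 / 2) * (qPsi b q * qPsi b q * (lift q (velPsi b) * q.1))

noncomputable def defW : ℝ := lift q (velNfW b) + factor b q * (nfU b q * nfV b q)

noncomputable def defX : ℝ := lift q (defectX b)

noncomputable def defZ : ℝ := lift q (defectZ b)

end

theorem lift_scale (F : ℝ → ℝ → ℝ → ℝ → ℝ → ℝ) (s : ℝ) (q : State) :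
    lift (scale s q) F =
      F (s^2 * qA q) (s^2 * qB q) (s * q.2.2.1) (s^2 * q.2.2.2.1) (s^2 * q.2.2.2.2) := by
  have h1 : qA (scale s q) = s^2 * qA q := by simp only [qA, scale]; ring
  have h2 : qB (scale s q) = s^2 * qB q := by simp only [qB, scale]; ring
  rw [lift, h1, h2]
  rfl

section

variable (b : ℝ)

theorem hasWeight_qA : HasWeight 2 qA :=
  ⟨fun y => qA y.2, by unfold qA; fun_prop, fun s q => by simp only [qA, scale]; ring⟩

theorem hasWeight_qPsi : HasWeight 2 (qPsi b) := by
  refine ⟨fun y => (1 + (1 - b^2 / 2) * (y.1^2 * qA y.2)) * y.2.2.2.2.1 - b * qB y.2 / 4,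
    by unfold qA qB; fun_prop, fun s q => ?_⟩
  simp only [qPsi, psi, qA, qB, scale]
  ring

theorem hasWeight_u : HasWeight 1 (fun q => q.1) :=
  ⟨fun y => y.2.1, by fun_prop, fun s q => by simp only [scale]; ring⟩

theorem hasWeight_v : HasWeight 1 (fun q => q.2.1) :=
  ⟨fun y => y.2.2.1, by fun_prop, fun s q => by simp only [scale]; ring⟩

theorem hasWeight_lift {F : ℝ → ℝ → ℝ → ℝ → ℝ → ℝ} {n : ℕ}
    {G : ℝ → ℝ → ℝ → ℝ → ℝ → ℝ → ℝ → ℝ → ℝ → ℝ → ℝ → ℝ}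
    (h : ∀ s A B w f g, F (s^2 * A) (s^2 * B) (s * w) (s^2 * f) (s^2 * g)
      = s^n * G s A B w f g (slowZTail b s A B w) (slowXRotTail b s A B w)
        (slowZRotTail b s A B w) (resXTail b s A B w) (resZTail b s A B w))
    (hG : ∀ s A B w f g ζ ξ η ρ₁ ρ₂ : ℝ × State → ℝ, ContDiff ℝ 1 s → ContDiff ℝ 1 A →
      ContDiff ℝ 1 B → ContDiff ℝ 1 w → ContDiff ℝ 1 f → ContDiff ℝ 1 g → ContDiff ℝ 1 ζ →
      ContDiff ℝ 1 ξ → ContDiff ℝ 1 η → ContDiff ℝ 1 ρ₁ → ContDiff ℝ 1 ρ₂ →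
      ContDiff ℝ 1 (fun y =>
        G (s y) (A y) (B y) (w y) (f y) (g y) (ζ y) (ξ y) (η y) (ρ₁ y) (ρ₂ y))) :
    HasWeight n (fun q => lift q F) := by
  refine ⟨_, hG (fun y => y.1) (fun y => qA y.2) (fun y => qB y.2) (fun y => y.2.2.2.1)
    (fun y => y.2.2.2.2.1) (fun y => y.2.2.2.2.2)
    (fun y => slowZTail b y.1 (qA y.2) (qB y.2) y.2.2.2.1)
    (fun y => slowXRotTail b y.1 (qA y.2) (qB y.2) y.2.2.2.1)
    (fun y => slowZRotTail b y.1 (qA y.2) (qB y.2) y.2.2.2.1)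
    (fun y => resXTail b y.1 (qA y.2) (qB y.2) y.2.2.2.1)
    (fun y => resZTail b y.1 (qA y.2) (qB y.2) y.2.2.2.1)
    ?_ ?_ ?_ ?_ ?_ ?_ ?_ ?_ ?_ ?_ ?_, fun s q => (lift_scale _ s q).trans (h ..)⟩
  all_goals
    first | fun_prop | (unfold qA; fun_prop) | (unfold qB; fun_prop) |
      (unfold slowZTail z5 z7 qA qB; fun_prop) |
      (unfold slowXRotTail x4Rot x6Rot x8Rot qA qB; fun_prop) |
      (unfold slowZRotTail z5Rot z7Rot qA qB; fun_prop) |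
      (unfold resXTail z3 z5 z7 x2Rot x4Rot x6Rot x8Rot x8W qA qB; fun_prop) |
      (unfold resZTail z3 z5 z7 z3Rot z5Rot z7Rot qA qB; fun_prop)

theorem hasWeight_theta : HasWeight 5 (fun q => lift q (theta b)) :=
  hasWeight_lift b (theta_scale b) (by intros; unfold thetaCore; fun_prop)

theorem hasWeight_velPsi : HasWeight 1 (fun q => lift q (velPsi b)) :=
  hasWeight_lift b (fun s A B w f g => by rw [pow_one]; exact velPsi_scale b s A B w f g)
    (by intros; unfold velPsiCore; fun_prop)

theorem hasWeight_defectW : HasWeight 6 (fun q => lift q (defectW b)) :=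
  hasWeight_lift b (defectW_scale b) (by intros; unfold defectWCore; fun_prop)

theorem hasWeight_defX : HasWeight 6 (defX b) :=
  hasWeight_lift b (defectX_scale b) (by intros; unfold defectXCore; fun_prop)

theorem hasWeight_defZ : HasWeight 6 (defZ b) :=
  hasWeight_lift b (defectZ_scale b) (by intros; unfold defectZCore; fun_prop)

/-- The state with the same slow variables and no deviation. -/
def slowPart (q : State) : State := (q.1, q.2.1, q.2.2.1, 0, 0)

theorem hasWeight_defX_slowPart : HasWeight 9 (fun q => defX b (slowPart q)) := by
  refine hasWeight_lift b (F := fun A B w _ _ => defectX b A B w 0 0)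
    (G := fun s A B w _ _ _ _ _ ρ₁ ρ₂ => (-1 + 3 / 4 * b^2 * (s^2 * A)) * ρ₁
      + 3 / 2 * b^2 * (s^4 * w * B) * ρ₂) (fun s A B w f g => ?_) (by intros; fun_prop)
  have h := defectX_scale b s A B w 0 0
  simp only [mul_zero] at h
  simp only [h, defectXCore]
  ring

theorem hasWeight_defZ_slowPart : HasWeight 9 (fun q => defZ b (slowPart q)) := by
  refine hasWeight_lift b (F := fun A B w _ _ => defectZ b A B w 0 0)
    (G := fun s A B w _ _ _ _ _ ρ₁ ρ₂ => s * ((-1 + 1 / 4 * b^2 * (s^2 * A)) * ρ₂))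
    (fun s A B w f g => ?_) (by intros; fun_prop)
  have h := defectZ_scale b s A B w 0 0
  simp only [mul_zero] at h
  simp only [h, defectZCore]
  ring

theorem hasWeight_nfU : HasWeight 1 (nfU b) :=
  ((hasWeight_u.add (((hasWeight_qPsi b).mul hasWeight_v).const_mul b |>.mono (by norm_num))).add
    ((((hasWeight_qPsi b).mul (hasWeight_qPsi b)).mul hasWeight_u).const_mul (-(b^2 / 2))
      |>.mono (by norm_num))).congr fun q => by simp only [nfU]; ring

theorem hasWeight_nfV : HasWeight 1 (nfV b) :=
  ((hasWeight_v.add (((hasWeight_qPsi b).mul hasWeight_u).const_mul (-b) |>.mono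
    (by norm_num))).add
    ((((hasWeight_qPsi b).mul (hasWeight_qPsi b)).mul hasWeight_v).const_mul (-(b^2 / 2))
      |>.mono (by norm_num))).congr fun q => by simp only [nfV]; ring

theorem hasWeight_defU : HasWeight 6 (defU b) :=
  ((hasWeight_theta b).mul (hasWeight_nfV b)).add
    ((((hasWeight_qPsi b).mul (hasWeight_qPsi b)).mul
      ((hasWeight_velPsi b).mul hasWeight_v)).const_mul _)

theorem hasWeight_defV : HasWeight 6 (defV b) :=
  (((hasWeight_theta b).mul (hasWeight_nfU b)).const_mul _).add
    ((((hasWeight_qPsi b).mul (hasWeight_qPsi b)).mul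
      ((hasWeight_velPsi b).mul hasWeight_u)).const_mul _)

theorem hasWeight_defW : HasWeight 6 (defW b) := by
  have hrest : HasWeight 6 (fun q : State => qPsi b q * qPsi b q * (factor b q *
      (-b^2 * qB q + b^3 / 2 * qPsi b q * qA q + b^4 / 8 * qPsi b q^2 * qB q))) := by
    refine HasWeight.mul (m := 4) (n := 2) ((hasWeight_qPsi b).mul (hasWeight_qPsi b)) ?_
    refine ⟨fun y => factor b (scale y.1 y.2) * (-b^2 * qB y.2
      + b^3 / 2 * qPsi b (scale y.1 y.2) * qA y.2
      + b^4 / 8 * qPsi b (scale y.1 y.2)^2 * qB y.2), ?_, fun s q => ?_⟩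
    · unfold factor qPsi psi qA qB scale
      fun_prop
    · simp only [factor, qPsi, qA, qB, scale]
      ring
  refine ((hasWeight_defectW b).add hrest).congr fun q => ?_
  simp only [defW, lift, defectW, nfU, nfV, factor, qPsi]
  generalize psi b (qA q) (qB q) q.2.2.2.1 = p
  simp only [qA, qB]
  ring

end

section

variable {b t : ℝ} {γ : ℝ → State}

theorem hasDerivAt_components (h : HasDerivAt γ (field b (γ t)) t) :
    HasDerivAt (fun t => (γ t).1) (field b (γ t)).1 t ∧
    HasDerivAt (fun t => (γ t).2.1) (field b (γ t)).2.1 t ∧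
    HasDerivAt (fun t => (γ t).2.2.1) (field b (γ t)).2.2.1 t ∧
    HasDerivAt (fun t => (γ t).2.2.2.1) (field b (γ t)).2.2.2.1 t ∧
    HasDerivAt (fun t => (γ t).2.2.2.2) (field b (γ t)).2.2.2.2 t := by
  have h' := hasDerivAt_iff_hasFDerivAt.1 h
  refine ⟨?_, ?_, ?_, ?_, ?_⟩
  · simpa using h'.fst.hasDerivAt
  · simpa using h'.snd.fst.hasDerivAt
  · simpa using h'.snd.snd.fst.hasDerivAt
  · simpa using h'.snd.snd.snd.fst.hasDerivAt
  · simpa using h'.snd.snd.snd.snd.hasDerivAt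

theorem hasDerivAt_qA (h : HasDerivAt γ (field b (γ t)) t) :
    HasDerivAt (fun t => qA (γ t))
      (-(2 * rate b (qA (γ t)) (qB (γ t)) (γ t).2.2.1 (γ t).2.2.2.2 * qB (γ t))) t := by
  obtain ⟨hu, hv, -, -, -⟩ := hasDerivAt_components h
  refine ((hu.fun_pow 2).fun_sub (hv.fun_pow 2)).congr_deriv ?_
  simp only [field, qB]
  ring

theorem hasDerivAt_qB (h : HasDerivAt γ (field b (γ t)) t) :
    HasDerivAt (fun t => qB (γ t))
      (2 * rate b (qA (γ t)) (qB (γ t)) (γ t).2.2.1 (γ t).2.2.2.2 * qA (γ t)) t := by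
  obtain ⟨hu, hv, -, -, -⟩ := hasDerivAt_components h
  refine ((hu.const_mul 2).fun_mul hv).congr_deriv ?_
  simp only [field, qA]
  ring

theorem hasDerivAt_w (h : HasDerivAt γ (field b (γ t)) t) :
    HasDerivAt (fun t => (γ t).2.2.1) (-(qB (γ t) / 2)) t := by
  refine (hasDerivAt_components h).2.2.1.congr_deriv ?_
  simp only [field, qB]
  ring

theorem hasDerivAt_qPsi (h : HasDerivAt γ (field b (γ t)) t) :
    HasDerivAt (fun t => qPsi b (γ t)) (lift (γ t) (velPsi b)) t := by
  obtain ⟨-, -, -, hx, -⟩ := hasDerivAt_components h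
  refine (((((hasDerivAt_qA h).const_mul _).const_add _).fun_mul hx).fun_sub
    (((hasDerivAt_qB h).const_mul _).div_const _)).congr_deriv ?_
  simp only [lift, velPsi, field]

theorem hasDerivAt_nfU (h : HasDerivAt γ (field b (γ t)) t) :
    HasDerivAt (fun t => nfU b (γ t))
      (-(factor b (γ t) * nfWq b (γ t) * nfV b (γ t)) + defU b (γ t)) t := by
  obtain ⟨hu, hv, -, -, -⟩ := hasDerivAt_components h
  have hp := hasDerivAt_qPsi h
  refine ((hu.fun_add ((hp.const_mul b).fun_mul hv)).fun_sub
    (((hp.fun_pow 2).const_mul (b^2 / 2)).fun_mul hu)).congr_deriv ?_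
  simp only [defU, nfV, factor, nfWq, lift, theta, field]
  ring

theorem hasDerivAt_nfV (h : HasDerivAt γ (field b (γ t)) t) :
    HasDerivAt (fun t => nfV b (γ t))
      (factor b (γ t) * nfWq b (γ t) * nfU b (γ t) + defV b (γ t)) t := by
  obtain ⟨hu, hv, -, -, -⟩ := hasDerivAt_components h
  have hp := hasDerivAt_qPsi h
  refine ((hv.fun_sub ((hp.const_mul b).fun_mul hu)).fun_sub
    (((hp.fun_pow 2).const_mul (b^2 / 2)).fun_mul hv)).congr_deriv ?_
  simp only [defV, nfU, factor, nfWq, lift, theta, field]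
  ring

theorem hasDerivAt_nfWq (h : HasDerivAt γ (field b (γ t)) t) :
    HasDerivAt (fun t => nfWq b (γ t))
      (-(factor b (γ t) * (nfU b (γ t) * nfV b (γ t))) + defW b (γ t)) t := by
  obtain ⟨-, -, -, hx, hz⟩ := hasDerivAt_components h
  have hw := hasDerivAt_w h
  refine ((hw.fun_add (((hasDerivAt_qA h).const_mul b).fun_mul hz)).fun_sub
    (((hw.const_mul (2 * b)).fun_mul (hasDerivAt_qB h)).fun_mul hx)).congr_deriv ?_
  simp only [defW, lift, velNfW, field]
  ring

theorem hasDerivAt_nfXq (h : HasDerivAt γ (field b (γ t)) t) :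
    HasDerivAt (fun t => nfXq b (γ t))
      (-(freq b (qA (γ t)) * nfZq b (γ t)) + defX b (γ t)) t := by
  obtain ⟨-, -, -, hx, hz⟩ := hasDerivAt_components h
  refine ((((((hasDerivAt_qA h).const_mul (b^2)).const_mul (3 / 4)).const_sub 1).fun_mul hx).fun_sub
    (((((hasDerivAt_w h).const_mul (b^2)).fun_mul (hasDerivAt_qB h)).const_mul
      (3 / 2)).fun_mul hz)).congr_deriv ?_
  simp only [nfZq, defX, lift, defectX, velNfX, field]
  ring

theorem hasDerivAt_nfZq (h : HasDerivAt γ (field b (γ t)) t) :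
    HasDerivAt (fun t => nfZq b (γ t))
      (freq b (qA (γ t)) * nfXq b (γ t) + defZ b (γ t)) t := by
  obtain ⟨-, -, -, -, hz⟩ := hasDerivAt_components h
  refine (((((hasDerivAt_qA h).const_mul (b^2)).const_mul (1 / 4)).const_sub 1).fun_mul
    hz).congr_deriv ?_
  simp only [nfXq, defZ, lift, defectZ, velNfZ, field]
  ring

end

/-- States whose components are bounded by `M` times the scale factors of `scale s`. -/
def Box (M s : ℝ) (q : State) : Prop :=
  |q.1| ≤ M * s ∧ |q.2.1| ≤ M * s ∧ |q.2.2.1| ≤ M * s ∧ |q.2.2.2.1| ≤ M * s^2 ∧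
    |q.2.2.2.2| ≤ M * s^2

theorem Box.exists_scale {M s : ℝ} {q : State} (hs : 0 < s) (h : Box M s q) :
    scale s⁻¹ q ∈ Metric.closedBall (0 : State) M := by
  obtain ⟨h1, h2, h3, h4, h5⟩ := h
  have key : ∀ {x c : ℝ}, 0 < c → |x| ≤ M * c → |c⁻¹ * x| ≤ M := fun {x c} hc hx => by
    rw [abs_mul, abs_of_pos (inv_pos.2 hc), inv_mul_le_iff₀ hc]
    linarith
  simp only [mem_closedBall_zero_iff, scale, Prod.norm_mk, Real.norm_eq_abs, sup_le_iff, inv_pow]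
  exact ⟨key hs h1, key hs h2, key hs h3, key (by positivity) h4, key (by positivity) h5⟩

theorem scale_scale_inv {s : ℝ} (hs : s ≠ 0) (q : State) : scale s (scale s⁻¹ q) = q := by
  simp [scale, hs]

theorem norm_scale_inv_sub_le {s : ℝ} (hs : 0 < s) (hs1 : s ≤ 1) (p q : State) :
    ‖scale s⁻¹ p - scale s⁻¹ q‖ ≤ (s^2)⁻¹ * ‖p - q‖ := by
  have h1 : s⁻¹ ≤ (s^2)⁻¹ := inv_anti₀ (by positivity) (by nlinarith)
  have key : ∀ {c x y : ℝ}, 0 ≤ c → c ≤ (s^2)⁻¹ → |x - y| ≤ ‖p - q‖ →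
      |c * x - c * y| ≤ (s^2)⁻¹ * ‖p - q‖ := fun {c x y} hc hc' hxy => by
    rw [← mul_sub, abs_mul, abs_of_nonneg hc]
    gcongr
  have hn : ∀ r : State, |r.1| ≤ ‖r‖ ∧ |r.2.1| ≤ ‖r‖ ∧ |r.2.2.1| ≤ ‖r‖ ∧ |r.2.2.2.1| ≤ ‖r‖ ∧
      |r.2.2.2.2| ≤ ‖r‖ := fun r => by simp [Prod.norm_def]
  obtain ⟨a1, a2, a3, a4, a5⟩ := hn (p - q)
  have hi : (0 : ℝ) ≤ s⁻¹ := by positivity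
  have hi2 : (0 : ℝ) ≤ (s^2)⁻¹ := by positivity
  simp only [scale, Prod.mk_sub_mk, Prod.norm_mk, Real.norm_eq_abs, sup_le_iff, inv_pow]
  exact ⟨key hi h1 a1, key hi h1 a2, key hi h1 a3, key hi2 le_rfl a4, key hi2 le_rfl a5⟩

theorem HasWeight.bound {n : ℕ} {Q : State → ℝ} (hQ : HasWeight n Q) (M : ℝ) :
    ∃ C, 0 ≤ C ∧ ∀ s, 0 < s → s ≤ 1 → ∀ p, Box M s p → |Q p| ≤ C * s^n ∧
      ∀ q, Box M s q → s^2 * |Q p - Q q| ≤ C * s^n * ‖p - q‖ := by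
  obtain ⟨P, hP, hQP⟩ := hQ
  set K : Set (ℝ × State) := Metric.closedBall 0 (max 1 M)
  have hK : IsCompact K := isCompact_closedBall _ _
  have hKc : Convex ℝ K := convex_closedBall _ _
  obtain ⟨C₁, hC₁⟩ := hK.exists_bound_of_continuousOn hP.continuous.continuousOn
  obtain ⟨C₂, hC₂⟩ := hK.exists_bound_of_continuousOn
    (hP.continuous_fderiv (by norm_num)).continuousOn
  have hmem : ∀ {s q}, 0 < s → s ≤ 1 → Box M s q → (s, scale s⁻¹ q) ∈ K := fun {s q} h0 h1 hq => by
    have := hq.exists_scale h0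
    rw [mem_closedBall_zero_iff] at this ⊢
    rw [Prod.norm_mk, Real.norm_eq_abs, abs_of_pos h0]
    exact max_le_max h1 this
  have hval : ∀ {s q}, 0 < s → Q q = s^n * P (s, scale s⁻¹ q) := fun {s q} h0 => by
    rw [← hQP, scale_scale_inv h0.ne']
  refine ⟨max 0 (max C₁ C₂), le_max_left _ _, fun s h0 h1 p hp => ⟨?_, fun q hq => ?_⟩⟩
  · rw [hval h0, abs_mul, abs_of_pos (by positivity), mul_comm]
    gcongr
    exact (hC₁ _ (hmem h0 h1 hp)).trans ((le_max_left _ _).trans (le_max_right _ _))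
  · have hd : |P (s, scale s⁻¹ p) - P (s, scale s⁻¹ q)| ≤
        max 0 (max C₁ C₂) * ((s^2)⁻¹ * ‖p - q‖) := by
      have := hKc.norm_image_sub_le_of_norm_fderiv_le (𝕜 := ℝ) (f := P) (C := C₂)
        (fun x _ => hP.differentiable (by norm_num) x) hC₂ (hmem h0 h1 hq) (hmem h0 h1 hp)
      refine this.trans ?_
      gcongr
      · exact (le_max_right _ _).trans (le_max_right _ _)
      · simpa [Prod.norm_mk] using norm_scale_inv_sub_le h0 h1 p q
    rw [hval (q := p) h0, hval (q := q) h0, ← mul_sub, abs_mul, abs_of_pos (by positivity)]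
    calc s^2 * (s^n * |P (s, scale s⁻¹ p) - P (s, scale s⁻¹ q)|)
        ≤ s^2 * (s^n * (max 0 (max C₁ C₂) * ((s^2)⁻¹ * ‖p - q‖))) := by gcongr
      _ = _ := by field_simp

theorem growth_bounds {M M' : ℝ → ℝ} {k T : ℝ} (hk : 0 ≤ k) (hkT : k * T ≤ 1)
    (hd : ∀ t ∈ Set.Icc 0 T, HasDerivAt M (M' t) t)
    (hM : ∀ t ∈ Set.Icc 0 T, |M' t| ≤ k * M t) (h0 : 0 ≤ M 0) {t : ℝ} (ht : t ∈ Set.Icc 0 T) :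
    M 0 ≤ 3 * M t ∧ M t ≤ 3 * M 0 := by
  have h0T : (0 : ℝ) ∈ Set.Icc 0 T := ⟨le_rfl, ht.1.trans ht.2⟩
  have he : Real.exp (k * t) ≤ 3 := by
    have : k * t ≤ 1 := (mul_le_mul_of_nonneg_left ht.2 hk).trans hkT
    linarith [Real.exp_le_exp.2 this, Real.exp_one_lt_d9]
  have hexp : ∀ c r : ℝ, HasDerivAt (fun r => Real.exp (c * r)) (Real.exp (c * r) * c) r :=
      fun c r => by
    simpa using ((hasDerivAt_id r).const_mul c).exp
  have hup : MonotoneOn (fun r => M r * Real.exp (k * r)) (Set.Icc 0 T) := by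
    refine monotoneOn_of_hasDerivWithinAt_nonneg (convex_Icc 0 T)
      (f' := fun r => M' r * Real.exp (k * r) + M r * (Real.exp (k * r) * k))
      (fun r hr => ((hd r hr).mul (hexp k r)).continuousAt.continuousWithinAt)
      (fun r hr => ((hd r (interior_subset hr)).mul (hexp k r)).hasDerivWithinAt) fun r hr => ?_
    have := neg_le_of_abs_le (hM r (interior_subset hr))
    nlinarith [Real.exp_pos (k * r)]
  have hdn : AntitoneOn (fun r => M r * Real.exp (-k * r)) (Set.Icc 0 T) := by
    refine antitoneOn_of_hasDerivWithinAt_nonpos (convex_Icc 0 T)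
      (f' := fun r => M' r * Real.exp (-k * r) + M r * (Real.exp (-k * r) * -k))
      (fun r hr => ((hd r hr).mul (hexp (-k) r)).continuousAt.continuousWithinAt)
      (fun r hr => ((hd r (interior_subset hr)).mul (hexp (-k) r)).hasDerivWithinAt) fun r hr => ?_
    have := le_of_abs_le (hM r (interior_subset hr))
    nlinarith [Real.exp_pos (-k * r)]
  have h1 := hup h0T ht ht.1
  have h2 := hdn h0T ht ht.1
  simp only [mul_zero, Real.exp_zero, mul_one] at h1 h2
  have hpos : 0 < Real.exp (k * t) := Real.exp_pos _
  rw [neg_mul, Real.exp_neg, ← div_eq_mul_inv, div_le_iff₀ hpos] at h2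
  have hMt : 0 ≤ M t := by
    by_contra hneg
    nlinarith
  exact ⟨by nlinarith, by nlinarith⟩

/-- A fast oscillation `ε` whose comparison `f` with a slightly detuned copy of itself is small must
itself be small. -/
theorem oscillation_bound {ε₁ ε₂ f₁ f₂ ω θ ρ₁ ρ₂ σ₁ σ₂ : ℝ → ℝ} {C s : ℝ} (hC : 1 ≤ C) (hs : 0 < s)
    (dε₁ : ∀ t ∈ Set.Icc 0 (1 / (6 * C * s^4)), HasDerivAt ε₁ (-(ω t * ε₂ t) + ρ₁ t) t)
    (dε₂ : ∀ t ∈ Set.Icc 0 (1 / (6 * C * s^4)), HasDerivAt ε₂ (ω t * ε₁ t + ρ₂ t) t)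
    (df₁ : ∀ t ∈ Set.Icc 0 (1 / (6 * C * s^4)),
      HasDerivAt f₁ (-(ω t * f₂ t) + θ t * ε₂ t + σ₁ t) t)
    (df₂ : ∀ t ∈ Set.Icc 0 (1 / (6 * C * s^4)),
      HasDerivAt f₂ (ω t * f₁ t - θ t * ε₁ t + σ₂ t) t)
    (hθ : ∀ t ∈ Set.Icc 0 (1 / (6 * C * s^4)), s^4 / 2 ≤ θ t)
    (hf : ∀ t ∈ Set.Icc 0 (1 / (6 * C * s^4)), |f₁ t| ≤ C * s^5 ∧ |f₂ t| ≤ C * s^5)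
    (hσ : ∀ t ∈ Set.Icc 0 (1 / (6 * C * s^4)), |σ₁ t| ≤ C * s^9 ∧ |σ₂ t| ≤ C * s^9)
    (hρ : ∀ t ∈ Set.Icc 0 (1 / (6 * C * s^4)),
      |ρ₁ t| ≤ C * (s^9 + s^4 * (|ε₁ t| + |ε₂ t|)) ∧
      |ρ₂ t| ≤ C * (s^9 + s^4 * (|ε₁ t| + |ε₂ t|))) :
    |ε₁ 0| ≤ 288 * C^2 * s^5 ∧ |ε₂ 0| ≤ 288 * C^2 * s^5 := by
  set T := 1 / (6 * C * s^4) with hT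
  have hC0 : 0 < C := by linarith
  have hT0 : 0 < T := by positivity
  set M : ℝ → ℝ := fun t => ε₁ t^2 + ε₂ t^2 + s^10 with hMdef
  have hM0 : 0 < M 0 := by simp only [hMdef]; positivity
  have hgrow : ∀ t ∈ Set.Icc 0 T, M 0 ≤ 3 * M t ∧ M t ≤ 3 * M 0 := fun t ht => by
    refine growth_bounds (M' := fun t => 2 * ε₁ t * ρ₁ t + 2 * ε₂ t * ρ₂ t) (k := 6 * C * s^4)
      (by positivity) (by rw [hT]; field_simp; norm_num) (fun t ht => ?_) (fun t ht => ?_) hM0.le ht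
    · refine ((((dε₁ t ht).fun_pow 2).fun_add ((dε₂ t ht).fun_pow 2)).add_const _).congr_deriv ?_
      ring
    · obtain ⟨h1, h2⟩ := hρ t ht
      set a := |ε₁ t| with ha
      set c := |ε₂ t| with hc
      have ha0 : 0 ≤ a := abs_nonneg _
      have hc0 : 0 ≤ c := abs_nonneg _
      have hM : M t = a^2 + c^2 + s^10 := by simp only [hMdef, ha, hc, sq_abs]
      calc |2 * ε₁ t * ρ₁ t + 2 * ε₂ t * ρ₂ t|
          ≤ |2 * ε₁ t * ρ₁ t| + |2 * ε₂ t * ρ₂ t| := abs_add_le _ _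
        _ = 2 * a * |ρ₁ t| + 2 * c * |ρ₂ t| := by simp only [abs_mul, abs_two, ha, hc]
        _ ≤ 2 * a * (C * (s^9 + s^4 * (a + c))) + 2 * c * (C * (s^9 + s^4 * (a + c))) := by gcongr
        _ = 2 * C * s^4 * ((a + c) * s^5 + (a + c)^2) := by ring
        _ ≤ 2 * C * s^4 * (3 * (a^2 + c^2 + s^10)) := by
          gcongr
          nlinarith [sq_nonneg (a - c), sq_nonneg (a + c - s^5), pow_pos hs 10]
        _ = 6 * C * s^4 * M t := by rw [hM]; ring
  set μ := √(M 0) with hμ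
  have hμ2 : μ^2 = M 0 := Real.sq_sqrt hM0.le
  have hμ0 : 0 < μ := Real.sqrt_pos.2 hM0
  have hsμ : s^5 ≤ μ := by
    refine Real.le_sqrt_of_sq_le ?_
    simp only [hMdef]
    nlinarith [sq_nonneg (ε₁ 0), sq_nonneg (ε₂ 0)]
  have hsum : ∀ t ∈ Set.Icc 0 T, |ε₁ t| + |ε₂ t| ≤ 5 / 2 * μ := fun t ht => by
    refine abs_le_of_sq_le_sq' ?_ (by positivity) |>.2
    have h := (hgrow t ht).2
    simp only [← hμ2] at h
    have hM : M t = |ε₁ t|^2 + |ε₂ t|^2 + s^10 := by simp only [hMdef, sq_abs]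
    nlinarith [sq_nonneg (|ε₁ t| - |ε₂ t|), pow_pos hs 10]
  set φ : ℝ → ℝ := fun t => ε₁ t * f₂ t - ε₂ t * f₁ t with hφ
  have hφb : ∀ t ∈ Set.Icc 0 T, |φ t| ≤ 3 * μ * C * s^5 := fun t ht => by
    obtain ⟨h1, h2⟩ := hf t ht
    calc |φ t| ≤ |ε₁ t * f₂ t| + |ε₂ t * f₁ t| := abs_sub _ _
      _ ≤ |ε₁ t| * (C * s^5) + |ε₂ t| * (C * s^5) := by rw [abs_mul, abs_mul]; gcongr
      _ = (|ε₁ t| + |ε₂ t|) * (C * s^5) := by ring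
      _ ≤ 5 / 2 * μ * (C * s^5) := by gcongr; exact hsum t ht
      _ ≤ 3 * μ * C * s^5 := by nlinarith [show 0 < μ * C * s^5 by positivity]
  set D := s^4 * (-(μ^2 / 6) + 12 * C^2 * s^5 * μ) with hD
  have hφd : φ T - φ 0 ≤ D * (T - 0) := by
    have hder : ∀ t ∈ Set.Icc 0 T, HasDerivAt φ
        (-(θ t * (ε₁ t^2 + ε₂ t^2)) + (ρ₁ t * f₂ t - ρ₂ t * f₁ t)
        + (ε₁ t * σ₂ t - ε₂ t * σ₁ t)) t := fun t ht => by
      refine (((dε₁ t ht).fun_mul (df₂ t ht)).fun_sub ((dε₂ t ht).fun_mul (df₁ t ht))).congr_deriv ?_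
      ring
    refine Convex.image_sub_le_mul_sub_of_deriv_le (convex_Icc 0 T)
      (fun t ht => (hder t ht).continuousAt.continuousWithinAt)
      (fun t ht => (hder t (interior_subset ht)).differentiableAt.differentiableWithinAt)
      (fun t ht => ?_) 0 ⟨le_rfl, hT0.le⟩ T ⟨hT0.le, le_rfl⟩ hT0.le
    replace ht := interior_subset ht
    rw [(hder t ht).deriv]
    obtain ⟨f1, f2⟩ := hf t ht
    obtain ⟨g1, g2⟩ := hσ t ht
    obtain ⟨r1, r2⟩ := hρ t ht
    have he := hsum t ht
    have hlow := (hgrow t ht).1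
    rw [← hμ2] at hlow
    have e1 : |ρ₁ t * f₂ t - ρ₂ t * f₁ t| ≤ 2 * (C * (s^9 + s^4 * (5 / 2 * μ))) * (C * s^5) := by
      calc _ ≤ |ρ₁ t * f₂ t| + |ρ₂ t * f₁ t| := abs_sub _ _
        _ ≤ (C * (s^9 + s^4 * (5 / 2 * μ))) * (C * s^5)
            + (C * (s^9 + s^4 * (5 / 2 * μ))) * (C * s^5) := by
          rw [abs_mul, abs_mul]
          gcongr
          · exact r1.trans (by gcongr)
          · exact r2.trans (by gcongr)
        _ = _ := by ring
    have e2 : |ε₁ t * σ₂ t - ε₂ t * σ₁ t| ≤ 5 / 2 * μ * (C * s^9) := by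
      calc _ ≤ |ε₁ t * σ₂ t| + |ε₂ t * σ₁ t| := abs_sub _ _
        _ ≤ |ε₁ t| * (C * s^9) + |ε₂ t| * (C * s^9) := by rw [abs_mul, abs_mul]; gcongr
        _ = (|ε₁ t| + |ε₂ t|) * (C * s^9) := by ring
        _ ≤ _ := by gcongr
    have e3 : s^4 / 2 * (μ^2 / 3 - s^10) ≤ θ t * (ε₁ t^2 + ε₂ t^2) := by
      have : μ^2 / 3 - s^10 ≤ ε₁ t^2 + ε₂ t^2 := by simp only [hMdef] at hlow; linarith
      calc _ ≤ s^4 / 2 * (ε₁ t^2 + ε₂ t^2) := by gcongr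
        _ ≤ _ := by gcongr; exact hθ t ht
    have e4 : s^14 ≤ s^9 * μ := by
      calc s^14 = s^9 * s^5 := by ring
        _ ≤ _ := by gcongr
    have e5 : C * (s^9 * μ) ≤ C^2 * (s^9 * μ) := by
      gcongr
      nlinarith
    have e6 : s^9 * μ ≤ C * (s^9 * μ) := le_mul_of_one_le_left (by positivity) hC
    have e7 : C^2 * s^14 ≤ C^2 * (s^9 * μ) := by gcongr
    have := le_of_abs_le e1
    have := le_of_abs_le e2
    have e8 : 0 ≤ C^2 * (s^9 * μ) := by positivity
    rw [hD]
    linarith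
  have h1 := neg_le_of_abs_le (hφb T ⟨hT0.le, le_rfl⟩)
  have h2 := le_of_abs_le (hφb 0 ⟨le_rfl, hT0.le⟩)
  have hDT : D * (T - 0) = (-(μ^2 / 6) + 12 * C^2 * s^5 * μ) / (6 * C) := by
    rw [hD, hT]
    field_simp
    ring
  have hfin : -(6 * μ * C * s^5) * (6 * C) ≤ -(μ^2 / 6) + 12 * C^2 * s^5 * μ := by
    rw [hDT] at hφd
    exact (le_div_iff₀ (by positivity)).1 (by linarith)
  have hμle : μ ≤ 288 * C^2 * s^5 := by
    refine le_of_mul_le_mul_right ?_ hμ0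
    linarith
  constructor
  · refine le_trans (Real.abs_le_sqrt ?_) hμle
    simp only [hMdef]
    linarith [sq_nonneg (ε₂ 0), pow_pos hs 10]
  · refine le_trans (Real.abs_le_sqrt ?_) hμle
    simp only [hMdef]
    linarith [sq_nonneg (ε₁ 0), pow_pos hs 10]

/-- Near a definite quadratic-like invariant, trajectories exist for all times. -/
theorem exists_trajectory {E : Type*} [NormedAddCommGroup E] [NormedSpace ℝ E]
    [FiniteDimensional ℝ E] {F : E → E} {J : E → ℝ} {c r : ℝ} (hF : ContDiff ℝ 1 F)
    (hJ : Differentiable ℝ J) (hr : 0 < r) (hc : 1 ≤ c)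
    (hJF : ∀ p ∈ Metric.ball (0 : E) r, fderiv ℝ J p (F p) = 0)
    (hJ1 : ∀ p, ‖p‖^2 ≤ J p) (hJ2 : ∀ p ∈ Metric.ball (0 : E) r, J p ≤ c^2 * ‖p‖^2)
    {p₀ : E} (hp₀ : c * ‖p₀‖ ≤ r / 2) (T : ℝ) :
    ∃ p : ℝ → E, p 0 = p₀ ∧ ∀ t ∈ Set.Icc 0 T, HasDerivAt p (F (p t)) t ∧ ‖p t‖ ≤ c * ‖p₀‖ := by
  let χ : ContDiffBump (0 : E) := ⟨r / 2, r, by linarith, by linarith⟩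
  have hG : ContDiff ℝ 1 (fun p => χ p • F p) := χ.contDiff.smul hF
  have hGc : HasCompactSupport (fun p => χ p • F p) := χ.hasCompactSupport.smul_right
  obtain ⟨K, hK⟩ := hG.lipschitzWith_of_hasCompactSupport hGc (by norm_num)
  obtain ⟨L, hL⟩ := hGc.exists_bound_of_continuous hG.continuous
  rcases lt_or_ge T 0 with hT | hT
  · exact ⟨fun _ => p₀, rfl, fun t ht => absurd (ht.1.trans ht.2) (by linarith)⟩
  have h0 : (0 : ℝ) ∈ Set.Icc (-1) (T + 1) := ⟨by norm_num, by linarith⟩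
  have hPL : IsPicardLindelof (fun _ p => χ p • F p) (⟨0, h0⟩ : Set.Icc (-1) (T + 1)) p₀
      (L.toNNReal * (T + 1).toNNReal) 0 L.toNNReal K := by
    refine .of_time_independent (fun x _ => (hL x).trans (Real.le_coe_toNNReal L))
      hK.lipschitzOnWith ?_
    have : max (T + 1 - 0) (0 - (-1)) = T + 1 := by
      rw [max_eq_left (by linarith), sub_zero]
    simp only [this]
    rw [NNReal.coe_mul, Real.coe_toNNReal (T + 1) (by linarith)]
    simp
  obtain ⟨p, hp0, hp⟩ := hPL.exists_eq_forall_mem_Icc_hasDerivWithinAt₀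
  have hp' : ∀ t ∈ Set.Icc 0 T, HasDerivAt p (χ (p t) • F (p t)) t := fun t ht =>
    (hp t ⟨by linarith [ht.1], by linarith [ht.2]⟩).hasDerivAt
      (Icc_mem_nhds (by linarith [ht.1]) (by linarith [ht.2]))
  have hcons : ∀ t ∈ Set.Icc 0 T, J (p t) = J p₀ := by
    have hd : ∀ t ∈ Set.Icc 0 T, HasDerivAt (fun t => J (p t)) 0 t := fun t ht => by
      refine ((hJ (p t)).hasFDerivAt.comp_hasDerivAt t (hp' t ht)).congr_deriv ?_
      rw [map_smul, smul_eq_mul]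
      by_cases hb : p t ∈ Metric.ball (0 : E) r
      · rw [hJF _ hb, mul_zero]
      · rw [χ.zero_of_le_dist (not_lt.1 hb), zero_mul]
    intro t ht
    rw [constant_of_has_deriv_right_zero (fun t ht => (hd t ht).continuousAt.continuousWithinAt)
      (fun t ht => (hd t ⟨ht.1, ht.2.le⟩).hasDerivWithinAt) t ht]
    exact congrArg J hp0
  have hball : p₀ ∈ Metric.ball (0 : E) r := by
    rw [mem_ball_zero_iff]
    nlinarith [norm_nonneg p₀]
  have hbd : ∀ t ∈ Set.Icc 0 T, ‖p t‖ ≤ c * ‖p₀‖ := fun t ht => by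
    refine le_of_sq_le_sq ?_ (by positivity)
    rw [mul_pow]
    exact ((hJ1 _).trans (hcons t ht).le).trans (hJ2 _ hball)
  refine ⟨p, hp0, fun t ht => ⟨?_, hbd t ht⟩⟩
  have h1 : χ (p t) = 1 := χ.one_of_mem_closedBall
    (mem_closedBall_zero_iff.2 ((hbd t ht).trans hp₀))
  simpa [h1] using hp' t ht

theorem hasDerivAt_slowX {b t ν : ℝ} {A B w : ℝ → ℝ} (hA : HasDerivAt A (-(2 * ν * B t)) t)
    (hB : HasDerivAt B (2 * ν * A t) t) (hw : HasDerivAt w (-(B t / 2)) t) :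
    HasDerivAt (fun t => slowX b (A t) (B t) (w t))
      (2 * ν * slowXRot b (A t) (B t) (w t) - B t / 2 * slowXW b (A t) (B t) (w t)) t := by
  refine ((((hasDerivAt_x2 hA hB hw).fun_add (hasDerivAt_x4 hA hB hw)).fun_add
    (hasDerivAt_x6 hA hB hw)).fun_add (hasDerivAt_x8 hA hB hw)).congr_deriv ?_
  simp only [slowXRot, slowXW]
  ring

theorem hasDerivAt_slowZ {b t ν : ℝ} {A B w : ℝ → ℝ} (hA : HasDerivAt A (-(2 * ν * B t)) t)
    (hB : HasDerivAt B (2 * ν * A t) t) (hw : HasDerivAt w (-(B t / 2)) t) :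
    HasDerivAt (fun t => slowZ b (A t) (B t) (w t))
      (2 * ν * slowZRot b (A t) (B t) (w t) - B t / 2 * slowZW b (A t) (B t) (w t)) t := by
  refine (((hasDerivAt_z3 hA hB hw).fun_add (hasDerivAt_z5 hA hB hw)).fun_add
    (hasDerivAt_z7 hA hB hw)).congr_deriv ?_
  simp only [slowZRot, slowZW]
  ring

section

variable (b : ℝ) (hx hz : ℝ × ℝ × ℝ → ℝ) (p : ℝ × ℝ × ℝ)

/-- The slow vector field on the graph of `hx, hz`. -/
def slowField : ℝ × ℝ × ℝ :=
  (-p.2.1 * p.2.2 + b * p.2.1 * hz p, p.1 * p.2.2 - b * p.1 * hz p, -p.1 * p.2.1)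

/-- The invariance equations for the graph of `hx, hz`. -/
def Invariant : Prop :=
  fderiv ℝ hx p (slowField b hz p) = -hz p ∧
    fderiv ℝ hz p (slowField b hz p) = hx p + b * p.1 * p.2.1

/-- The state on the graph of `hx, hz`. -/
noncomputable def graph : State :=
  (p.1, p.2.1, p.2.2, hx p - slowX b (p.1^2 - p.2.1^2) (2 * p.1 * p.2.1) p.2.2,
    hz p - slowZ b (p.1^2 - p.2.1^2) (2 * p.1 * p.2.1) p.2.2)

end

section

variable {b : ℝ} {hx hz : ℝ × ℝ × ℝ → ℝ}

theorem contDiff_graph (cx : ContDiff ℝ 1 hx) (cz : ContDiff ℝ 1 hz) :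
    ContDiff ℝ 1 (graph b hx hz) := by
  unfold graph slowX slowZ x2 x4 x6 x8 z3 z5 z7
  fun_prop

theorem contDiff_slowField (cz : ContDiff ℝ 1 hz) : ContDiff ℝ 1 (slowField b hz) := by
  unfold slowField
  fun_prop

theorem hasDerivAt_graph (cx : Differentiable ℝ hx) (cz : Differentiable ℝ hz)
    {p : ℝ → ℝ × ℝ × ℝ} {t : ℝ} (hp : HasDerivAt p (slowField b hz (p t)) t)
    (hinv : Invariant b hx hz (p t)) :
    HasDerivAt (fun t => graph b hx hz (p t)) (field b (graph b hx hz (p t))) t := by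
  have h' := hasDerivAt_iff_hasFDerivAt.1 hp
  have hu : HasDerivAt (fun t => (p t).1) (slowField b hz (p t)).1 t := by
    simpa using h'.fst.hasDerivAt
  have hv : HasDerivAt (fun t => (p t).2.1) (slowField b hz (p t)).2.1 t := by
    simpa using h'.snd.fst.hasDerivAt
  have hw : HasDerivAt (fun t => (p t).2.2) (slowField b hz (p t)).2.2 t := by
    simpa using h'.snd.snd.hasDerivAt
  have dx := (cx (p t)).hasFDerivAt.comp_hasDerivAt t hp
  have dz := (cz (p t)).hasFDerivAt.comp_hasDerivAt t hp
  rw [hinv.1] at dx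
  rw [hinv.2] at dz
  set ν : ℝ := (p t).2.2 - b * hz (p t) with hν
  have hA : HasDerivAt (fun t => (p t).1^2 - (p t).2.1^2)
      (-(2 * ν * (2 * (p t).1 * (p t).2.1))) t := by
    refine ((hu.fun_pow 2).fun_sub (hv.fun_pow 2)).congr_deriv ?_
    simp only [slowField, hν]
    ring
  have hB : HasDerivAt (fun t => 2 * (p t).1 * (p t).2.1)
      (2 * ν * ((p t).1^2 - (p t).2.1^2)) t := by
    refine ((hu.const_mul 2).fun_mul hv).congr_deriv ?_
    simp only [slowField, hν]
    ring
  have hw' : HasDerivAt (fun t => (p t).2.2) (-(2 * (p t).1 * (p t).2.1 / 2)) t :=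
    hw.congr_deriv (by simp only [slowField]; ring)
  have hX := hasDerivAt_slowX (b := b) (A := fun t => (p t).1^2 - (p t).2.1^2)
    (B := fun t => 2 * (p t).1 * (p t).2.1) (w := fun t => (p t).2.2) hA hB hw'
  have hZ := hasDerivAt_slowZ (b := b) (A := fun t => (p t).1^2 - (p t).2.1^2)
    (B := fun t => 2 * (p t).1 * (p t).2.1) (w := fun t => (p t).2.2) hA hB hw'
  refine (hu.prodMk (hv.prodMk (hw.prodMk ((dx.fun_sub hX).prodMk (dz.fun_sub hZ))))).congr_deriv ?_
  simp only [field, graph, slowField, rate, velX, velZ, resX, resZ, slowXRot, slowZRot, slowXW,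
    slowZW, qA, qB, hν, Prod.mk.injEq, slowZ, slowX]
  refine ⟨?_, ?_, ?_, ?_, ?_⟩ <;> ring

/-- Derivatives along the slow vector field can be computed with the equations of motion. -/
theorem fderiv_slowField_eq (cx : ContDiff ℝ 1 hx) (cz : ContDiff ℝ 1 hz) {p : ℝ × ℝ × ℝ}
    (hinv : Invariant b hx hz p) {Q : State → ℝ} (hQ : ContDiff ℝ 1 Q) {d : ℝ}
    (h : ∀ γ : ℝ → State, γ 0 = graph b hx hz p → HasDerivAt γ (field b (γ 0)) 0 →
      HasDerivAt (fun t => Q (γ t)) d 0) :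
    fderiv ℝ (fun p => Q (graph b hx hz p)) p (slowField b hz p) = d := by
  set c : ℝ → ℝ × ℝ × ℝ := fun t => p + t • slowField b hz p with hc
  have hc0 : c 0 = p := by simp [hc]
  have hdc : HasDerivAt c (slowField b hz (c 0)) 0 := by
    rw [hc0]
    exact (((hasDerivAt_id (0 : ℝ)).smul_const (slowField b hz p)).const_add p).congr_deriv
      (one_smul ℝ _)
  have h1 := h (fun t => graph b hx hz (c t)) (by rw [hc0])
    (hasDerivAt_graph (cx.differentiable one_ne_zero) (cz.differentiable one_ne_zero) hdc
      (by rwa [hc0]))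
  have h2 := (((hQ.comp (contDiff_graph (b := b) cx cz)).differentiable one_ne_zero
    (c 0)).hasFDerivAt.comp_hasDerivAt 0 hdc).unique h1
  rwa [hc0] at h2

end

theorem abs_le_norm_triple (p : ℝ × ℝ × ℝ) : |p.1| ≤ ‖p‖ ∧ |p.2.1| ≤ ‖p‖ ∧ |p.2.2| ≤ ‖p‖ := by
  simp [Prod.norm_def]

theorem HasWeight.isBigO {n : ℕ} (hn : n ≠ 0) {Q : State → ℝ} (hQ : HasWeight n Q) :
    (fun p : ℝ × ℝ × ℝ => Q (p.1, p.2.1, p.2.2, 0, 0)) =O[𝓝 0] fun p => ‖p‖^n := by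
  obtain ⟨C, -, hC⟩ := hQ.bound 1
  refine IsBigO.of_bound C ?_
  filter_upwards [Metric.ball_mem_nhds 0 one_pos] with p hp
  rcases eq_or_ne p 0 with rfl | h0
  · obtain ⟨P, -, hP⟩ := hQ
    have := hP 0 0
    simp only [scale, zero_mul, ne_eq, hn, not_false_eq_true, zero_pow] at this
    simpa [hn] using this
  · obtain ⟨h1, h2, h3⟩ := abs_le_norm_triple p
    rw [norm_pow, norm_norm, Real.norm_eq_abs]
    exact (hC ‖p‖ (norm_pos_iff.2 h0) (mem_ball_zero_iff.1 hp).le _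
      ⟨by simpa using h1, by simpa using h2, by simpa using h3, by simp, by simp⟩).1

theorem isBigO_slowX_tail (b : ℝ) :
    (fun p : ℝ × ℝ × ℝ => slowX b (p.1^2 - p.2.1^2) (2 * p.1 * p.2.1) p.2.2 + b * p.1 * p.2.1)
      =O[𝓝 0] fun p => ‖p‖^4 := by
  have h : HasWeight 4 (fun q => lift q fun A B w _ _ => slowX b A B w - x2 b A B w) :=
    hasWeight_lift b (G := fun s A B w _ _ _ _ _ _ _ =>
      x4 b A B w + s^2 * x6 b A B w + s^4 * x8 b A B w)
      (fun s A B w f g => by simp only [slowX, x2, x4, x6, x8]; ring)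
      (by intros; unfold x4 x6 x8; fun_prop)
  refine (h.isBigO (by norm_num)).congr_left fun p => ?_
  simp only [lift, qA, qB, x2]
  ring

theorem isBigO_slowZ_tail (b : ℝ) :
    (fun p : ℝ × ℝ × ℝ => slowZ b (p.1^2 - p.2.1^2) (2 * p.1 * p.2.1) p.2.2
      - b * (p.1^2 - p.2.1^2) * p.2.2) =O[𝓝 0] fun p => ‖p‖^5 := by
  have h : HasWeight 5 (fun q => lift q fun A B w _ _ => slowZ b A B w - z3 b A B w) :=
    hasWeight_lift b (G := fun s A B w _ _ _ _ _ _ _ => z5 b A B w + s^2 * z7 b A B w)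
      (fun s A B w f g => by simp only [slowZ, z3, z5, z7]; ring)
      (by intros; unfold z5 z7; fun_prop)
  refine (h.isBigO (by norm_num)).congr_left fun p => ?_
  simp only [lift, qA, qB, z3]
  ring

/-- A differentiable function vanishing to first order at the origin is eventually small. -/
theorem eventually_abs_le_norm {E : Type*} [NormedAddCommGroup E] [NormedSpace ℝ E] {f : E → ℝ}
    (hf : DifferentiableAt ℝ f 0) (h0 : f 0 = 0) (h1 : fderiv ℝ f 0 = 0) :
    ∀ᶠ p in 𝓝 (0 : E), |f p| ≤ ‖p‖ := by
  have h := hf.hasFDerivAt.isLittleO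
  rw [h1] at h
  simpa [h0] using h.def one_pos

/-- A `C¹` function has small derivative near a critical point. -/
theorem eventually_norm_fderiv_le {E : Type*} [NormedAddCommGroup E] [NormedSpace ℝ E] {f : E → ℝ}
    (hf : ContDiff ℝ 1 f) (h1 : fderiv ℝ f 0 = 0) :
    ∀ᶠ p in 𝓝 (0 : E), ‖fderiv ℝ f p‖ ≤ 1 := by
  have h : Filter.Tendsto (fun p => ‖fderiv ℝ f p‖) (𝓝 0) (𝓝 0) := by
    simpa [h1] using (hf.continuous_fderiv one_ne_zero).norm.tendsto 0
  exact h.eventually_le_const one_pos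

section

variable {b : ℝ} {hx hz : ℝ × ℝ × ℝ → ℝ}

theorem isBigO_slowField (cz : ContDiff ℝ 1 hz) (z0 : hz 0 = 0) (dz0 : fderiv ℝ hz 0 = 0) :
    slowField b hz =O[𝓝 0] fun p => ‖p‖^2 := by
  refine IsBigO.of_bound (1 + |b|) ?_
  filter_upwards [eventually_abs_le_norm (cz.differentiable one_ne_zero 0) z0 dz0] with p hp
  obtain ⟨h1, h2, h3⟩ := abs_le_norm_triple p
  have hn := norm_nonneg p
  have hm : ∀ {x y : ℝ}, |x| ≤ ‖p‖ → |y| ≤ ‖p‖ → |x * y| ≤ ‖p‖^2 := fun {x y} hx hy => by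
    rw [abs_mul, sq]
    gcongr
  have key : ∀ {x y : ℝ}, |x| ≤ ‖p‖^2 → |y| ≤ ‖p‖^2 → |x + b * y| ≤ (1 + |b|) * ‖p‖^2 :=
    fun {x y} hx hy => by
      refine (abs_add_le _ _).trans ?_
      rw [abs_mul, add_mul, one_mul]
      gcongr
  rw [norm_pow, norm_norm]
  simp only [slowField, Prod.norm_mk, Real.norm_eq_abs, sup_le_iff]
  refine ⟨?_, ?_, ?_⟩
  · exact (congrArg abs (by ring)).trans_le
      (key (x := -(p.2.1 * p.2.2)) (by rw [abs_neg]; exact hm h2 h3) (hm h2 hp))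
  · exact (congrArg abs (by ring)).trans_le
      (key (hm h1 h3) (y := -(p.1 * hz p)) (by rw [abs_neg]; exact hm h1 hp))
  · rw [neg_mul, abs_neg]
    refine (hm h1 h2).trans (le_mul_of_one_le_left (by positivity) ?_)
    linarith [abs_nonneg b]

theorem isBigO_of_fderiv_slowField {f g : ℝ × ℝ × ℝ → ℝ} (cz : ContDiff ℝ 1 hz) (z0 : hz 0 = 0)
    (dz0 : fderiv ℝ hz 0 = 0) (cf : ContDiff ℝ 1 f) (df0 : fderiv ℝ f 0 = 0)
    (h : ∀ᶠ p in 𝓝 (0 : ℝ × ℝ × ℝ), fderiv ℝ f p (slowField b hz p) = g p) :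
    g =O[𝓝 0] fun p => ‖p‖^2 := by
  refine IsBigO.trans (IsBigO.of_bound 1 ?_) (isBigO_slowField (b := b) cz z0 dz0)
  filter_upwards [h, eventually_norm_fderiv_le cf df0] with p hp hd
  rw [← hp]
  exact ((fderiv ℝ f p).le_opNorm _).trans (by gcongr)

theorem exists_graph_bound (cx : ContDiff ℝ 1 hx) (cz : ContDiff ℝ 1 hz) (z0 : hz 0 = 0)
    (dx0 : fderiv ℝ hx 0 = 0) (dz0 : fderiv ℝ hz 0 = 0)
    (hinv : ∀ᶠ p in 𝓝 (0 : ℝ × ℝ × ℝ), Invariant b hx hz p) :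
    ∃ M, 0 ≤ M ∧ ∀ᶠ p in 𝓝 (0 : ℝ × ℝ × ℝ), |(graph b hx hz p).2.2.2.1| ≤ M * ‖p‖^2 ∧
      |(graph b hx hz p).2.2.2.2| ≤ M * ‖p‖^2 := by
  have hpow : ∀ {n : ℕ}, 2 ≤ n → (fun p : ℝ × ℝ × ℝ => ‖p‖^n) =O[𝓝 0] fun p => ‖p‖^2 :=
    fun h => by
      refine IsBigO.of_bound 1 ?_
      filter_upwards [Metric.ball_mem_nhds 0 one_pos] with p hp
      rw [norm_pow, norm_pow, norm_norm, one_mul]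
      exact pow_le_pow_of_le_one (norm_nonneg p) (mem_ball_zero_iff.1 hp).le h
  have h1 := isBigO_of_fderiv_slowField (b := b) cz z0 dz0 cx dx0 (hinv.mono fun p h => h.1)
  have h2 := isBigO_of_fderiv_slowField (b := b) cz z0 dz0 cz dz0 (hinv.mono fun p h => h.2)
  have h3 := (isBigO_slowX_tail b).trans (hpow (by norm_num))
  have h4 : (fun p : ℝ × ℝ × ℝ => b * (p.1^2 - p.2.1^2) * p.2.2) =O[𝓝 0] fun p => ‖p‖^2 := by
    have h : HasWeight 3 (fun q : State => b * qA q * q.2.2.1) :=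
      ⟨fun y => b * qA y.2 * y.2.2.2.1, by unfold qA; fun_prop,
        fun s q => by simp only [qA, scale]; ring⟩
    exact (h.isBigO (by norm_num)).trans (hpow (by norm_num))
  have h5 := (isBigO_slowZ_tail b).trans (hpow (by norm_num))
  have hX : (fun p => (graph b hx hz p).2.2.2.1) =O[𝓝 0] fun p => ‖p‖^2 :=
    (h2.sub h3).congr_left fun p => by simp only [graph]; ring
  have hZ : (fun p => (graph b hx hz p).2.2.2.2) =O[𝓝 0] fun p => ‖p‖^2 :=
    ((h1.add h4).add h5).neg_left.congr_left fun p => by simp only [graph]; ring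
  obtain ⟨M₁, hM₁, h⟩ := hX.exists_nonneg
  obtain ⟨M₂, -, h'⟩ := hZ.exists_nonneg
  refine ⟨max M₁ M₂, hM₁.trans (le_max_left _ _), ?_⟩
  filter_upwards [h.bound, h'.bound] with p hp hp'
  rw [norm_pow, norm_norm, Real.norm_eq_abs] at hp hp'
  exact ⟨hp.trans (by gcongr; exact le_max_left _ _), hp'.trans (by gcongr; exact le_max_right _ _)⟩

theorem exists_trajectory_slowField (cx : ContDiff ℝ 1 hx) (cz : ContDiff ℝ 1 hz)
    (x0 : hx 0 = 0) (z0 : hz 0 = 0) (dx0 : fderiv ℝ hx 0 = 0) (dz0 : fderiv ℝ hz 0 = 0)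
    (hinv : ∀ᶠ p in 𝓝 (0 : ℝ × ℝ × ℝ), Invariant b hx hz p) :
    ∀ᶠ p₀ in 𝓝 (0 : ℝ × ℝ × ℝ), ∀ T, ∃ p : ℝ → ℝ × ℝ × ℝ, p 0 = p₀ ∧
      ∀ t ∈ Set.Icc 0 T, HasDerivAt p (slowField b hz (p t)) t ∧ ‖p t‖ ≤ 3 * ‖p₀‖ := by
  obtain ⟨r, hr, h⟩ := Metric.eventually_nhds_iff_ball.1 ((hinv.and
    (eventually_abs_le_norm (cx.differentiable one_ne_zero 0) x0 dx0)).and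
    (eventually_abs_le_norm (cz.differentiable one_ne_zero 0) z0 dz0))
  set J : ℝ × ℝ × ℝ → ℝ := fun p => p.1^2 + 2 * p.2.1^2 + p.2.2^2 + hx p^2 + hz p^2 with hJdef
  have hJ : ContDiff ℝ 1 J := by fun_prop
  have hJd := hJ.differentiable one_ne_zero
  filter_upwards [Metric.ball_mem_nhds 0 (show 0 < r / 6 by linarith)] with p₀ hp₀ T
  rw [mem_ball_zero_iff] at hp₀
  refine exists_trajectory (contDiff_slowField cz) hJd hr (by norm_num : (1 : ℝ) ≤ 3)
    (fun p hp => ?_) (fun p => ?_) (fun p hp => ?_) (by linarith) T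
  · obtain ⟨⟨hi, -⟩, -⟩ := h p hp
    set c : ℝ → ℝ × ℝ × ℝ := fun t => p + t • slowField b hz p with hc
    have hc0 : c 0 = p := by simp [hc]
    have hdc : HasDerivAt c (slowField b hz p) 0 :=
      (((hasDerivAt_id (0 : ℝ)).smul_const (slowField b hz p)).const_add p).congr_deriv
        (one_smul ℝ _)
    have h' := hasDerivAt_iff_hasFDerivAt.1 hdc
    have hu : HasDerivAt (fun t => (c t).1) (slowField b hz p).1 0 := by
      simpa using h'.fst.hasDerivAt
    have hv : HasDerivAt (fun t => (c t).2.1) (slowField b hz p).2.1 0 := by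
      simpa using h'.snd.fst.hasDerivAt
    have hw : HasDerivAt (fun t => (c t).2.2) (slowField b hz p).2.2 0 := by
      simpa using h'.snd.snd.hasDerivAt
    have dx := (cx.differentiable one_ne_zero (c 0)).hasFDerivAt.comp_hasDerivAt 0 hdc
    have dz := (cz.differentiable one_ne_zero (c 0)).hasFDerivAt.comp_hasDerivAt 0 hdc
    rw [hc0, hi.1] at dx
    rw [hc0, hi.2] at dz
    have h1 := (hJd (c 0)).hasFDerivAt.comp_hasDerivAt 0 hdc
    rw [hc0] at h1
    refine h1.unique ((((((hu.fun_pow 2).fun_add ((hv.fun_pow 2).const_mul 2)).fun_add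
      (hw.fun_pow 2)).fun_add (dx.fun_pow 2)).fun_add (dz.fun_pow 2)).congr_deriv ?_)
    simp only [hc0, slowField, Function.comp_apply]
    ring
  · have hle : ∀ {x : ℝ}, x^2 ≤ J p → |x| ≤ √(J p) := Real.abs_le_sqrt
    have hJ0 : 0 ≤ J p := by simp only [hJdef]; positivity
    rw [← Real.sq_sqrt hJ0]
    gcongr
    simp only [Prod.norm_def, Real.norm_eq_abs, sup_le_iff]
    refine ⟨hle ?_, hle ?_, hle ?_⟩ <;> simp only [hJdef] <;> nlinarith [sq_nonneg p.1,
      sq_nonneg p.2.1, sq_nonneg p.2.2, sq_nonneg (hx p), sq_nonneg (hz p)]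
  · obtain ⟨⟨-, h4⟩, h5⟩ := h p hp
    obtain ⟨h1, h2, h3⟩ := abs_le_norm_triple p
    have hs : ∀ {x : ℝ}, |x| ≤ ‖p‖ → x^2 ≤ ‖p‖^2 := fun h => sq_le_sq' (abs_le.1 h).1 (abs_le.1 h).2
    simp only [hJdef]
    nlinarith [hs h1, hs h2, hs h3, hs h4, hs h5]

end

theorem HasWeight.exists_comparison {Q : State → ℝ} (hQ : HasWeight 6 Q) (M L : ℝ) :
    ∃ C, 0 ≤ C ∧ ∀ s, 0 < s → s ≤ 1 → ∀ P P', Box M s P → Box M s P' → ‖P - P'‖ ≤ L * s^5 →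
      ∀ μ χ, |μ - 1| ≤ 2 * s^4 → |χ - 1| ≤ 2 * s^4 → |μ * Q P - χ * Q P'| ≤ C * s^9 := by
  obtain ⟨C, hC0, hC⟩ := hQ.bound M
  refine ⟨C * |L| + 4 * C, by positivity, fun s h0 h1 P P' hP hP' hd μ χ hμ hχ => ?_⟩
  have hd' : |Q P - Q P'| ≤ C * |L| * s^9 := by
    have h2 := (hC s h0 h1 P hP).2 P' hP'
    have h3 : s^2 * |Q P - Q P'| ≤ s^2 * (C * |L| * s^9) := by
      calc _ ≤ C * s^6 * ‖P - P'‖ := h2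
        _ ≤ C * s^6 * (|L| * s^5) := by
          gcongr
          exact hd.trans (by gcongr; exact le_abs_self L)
        _ = _ := by ring
    exact le_of_mul_le_mul_left h3 (by positivity)
  have h6 : s^4 * s^6 ≤ s^9 := by
    rw [← pow_add]
    exact pow_le_pow_of_le_one h0.le h1 (by norm_num)
  have e1 : |(μ - 1) * Q P| ≤ 2 * C * s^9 := by
    rw [abs_mul]
    calc _ ≤ 2 * s^4 * (C * s^6) := by
          gcongr
          exact (hC s h0 h1 P hP).1
      _ = 2 * C * (s^4 * s^6) := by ring
      _ ≤ _ := by gcongr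
  have e2 : |(χ - 1) * Q P'| ≤ 2 * C * s^9 := by
    rw [abs_mul]
    calc _ ≤ 2 * s^4 * (C * s^6) := by
          gcongr
          exact (hC s h0 h1 P' hP').1
      _ = 2 * C * (s^4 * s^6) := by ring
      _ ≤ _ := by gcongr
  rw [abs_le] at *
  constructor <;> linarith [e1.1, e1.2, e2.1, e2.2, hd'.1, hd'.2]

theorem Box.slowPart {M s : ℝ} {P : State} (h : Box M s P) : Box M s (slowPart P) := by
  have h4 := (abs_nonneg _).trans h.2.2.2.1
  exact ⟨h.1, h.2.1, h.2.2.1, by simpa [LorenzFiveMode.slowPart] using h4,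
    by simpa [LorenzFiveMode.slowPart] using h4⟩

theorem HasWeight.exists_bound_of_slowPart {Q : State → ℝ} (hQ : HasWeight 6 Q)
    (hQ' : HasWeight 9 (fun q => Q (slowPart q))) (M : ℝ) :
    ∃ C, 0 ≤ C ∧ ∀ s, 0 < s → s ≤ 1 → ∀ P, Box M s P →
      |Q P| ≤ C * (s^9 + s^4 * (|P.2.2.2.1| + |P.2.2.2.2|)) := by
  obtain ⟨C, hC0, hC⟩ := hQ.bound M
  obtain ⟨C', hC0', hC'⟩ := hQ'.bound M
  refine ⟨C + C', by positivity, fun s h0 h1 P hP => ?_⟩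
  set d := |P.2.2.2.1| + |P.2.2.2.2|
  have hd : ‖P - LorenzFiveMode.slowPart P‖ ≤ d := by
    simp [LorenzFiveMode.slowPart, Prod.norm_def, d]
  have h2 : |Q P - Q (LorenzFiveMode.slowPart P)| ≤ C * s^4 * d := by
    refine le_of_mul_le_mul_left (((hC s h0 h1 P hP).2 _ hP.slowPart).trans ?_)
      (show 0 < s^2 by positivity)
    calc _ ≤ C * s^6 * d := by gcongr
      _ = _ := by ring
  have h3 := (hC' s h0 h1 P hP).1
  have h4 : 0 ≤ C * s^9 := by positivity
  have h5 : 0 ≤ C' * (s^4 * d) := by positivity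
  calc |Q P| ≤ |Q P - Q (LorenzFiveMode.slowPart P)| + |Q (LorenzFiveMode.slowPart P)| := by
        linarith [abs_sub_abs_le_abs_sub (Q P) (Q (LorenzFiveMode.slowPart P))]
    _ ≤ C * s^4 * d + C' * s^9 := add_le_add h2 h3
    _ ≤ _ := by linarith

theorem frequency_gap {φ φ' δ : ℝ} (hδ : 0 < δ) (hδ1 : δ ≤ 1 / 16) (hφ : |φ| ≤ 1 / 16)
    (hφ' : |φ'| ≤ 1 / 16) (hd : |φ - φ'| ≤ δ / 16) :
    ∃ χ, χ * ((1 + δ) * (1 - φ')) = 1 - φ ∧ |χ - 1| ≤ 2 * δ ∧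
      δ / 2 ≤ 1 + φ - χ * (1 + φ') ∧ 1 + φ - χ * (1 + φ') ≤ 2 * δ := by
  rw [abs_le] at hφ hφ' hd
  have hD : 15 / 16 ≤ (1 + δ) * (1 - φ') := by nlinarith
  have hD' : (1 + δ) * (1 - φ') ≤ (17 / 16) * (17 / 16) := by nlinarith
  have hD0 : 0 < (1 + δ) * (1 - φ') := by linarith
  have hpr : φ * φ' ≤ 1 / 256 ∧ -(1 / 256) ≤ φ * φ' := by constructor <;> nlinarith
  have hpr' : δ * (φ * φ') ≤ δ / 256 ∧ -(δ / 256) ≤ δ * (φ * φ') := by constructor <;> nlinarith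
  have hpq : δ * (φ - φ') ≤ δ / 8 ∧ -(δ / 8) ≤ δ * (φ - φ') := by constructor <;> nlinarith
  have hq : δ * φ' ≤ δ / 16 ∧ -(δ / 16) ≤ δ * φ' := by constructor <;> nlinarith
  have key : 1 + φ - (1 - φ) / ((1 + δ) * (1 - φ')) * (1 + φ')
      = ((1 + φ) * ((1 + δ) * (1 - φ')) - (1 - φ) * (1 + φ')) / ((1 + δ) * (1 - φ')) := by
    rw [sub_div (_ * _), mul_div_cancel_right₀ _ hD0.ne', div_mul_eq_mul_div]
  refine ⟨(1 - φ) / ((1 + δ) * (1 - φ')), div_mul_cancel₀ _ hD0.ne', ?_, ?_, ?_⟩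
  · rw [div_sub_one hD0.ne', abs_div, abs_of_pos hD0, div_le_iff₀ hD0, abs_le]
    constructor <;> nlinarith
  · rw [key, le_div_iff₀ hD0]
    nlinarith
  · rw [key, div_le_iff₀ hD0]
    nlinarith

theorem eventually_const_mul_le {k c : ℝ} (hc : 0 < c) : ∀ᶠ s in 𝓝[>] (0 : ℝ), k * s ≤ c := by
  have h : Tendsto (fun s : ℝ => k * s) (𝓝[>] 0) (𝓝 0) := by
    have := ((continuous_const_mul k).tendsto 0).mono_left (nhdsWithin_le_nhds (s := Set.Ioi 0))
    rwa [mul_zero] at this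
  exact h.eventually_le_const hc

theorem eventually_forall_norm_le {E : Type*} [NormedAddCommGroup E] {P : E → Prop}
    (h : ∀ᶠ p in 𝓝 0, P p) (k : ℝ) : ∀ᶠ s in 𝓝[>] (0 : ℝ), ∀ p, ‖p‖ ≤ k * s → P p := by
  obtain ⟨r, hr, hP⟩ := Metric.eventually_nhds_iff_ball.1 h
  filter_upwards [eventually_const_mul_le (k := k) (half_pos hr)] with s hs p hp
  exact hP p (mem_ball_zero_iff.2 (by linarith))

theorem eventually_frequency_gap (b M L : ℝ) :
    ∀ᶠ s in 𝓝[>] (0 : ℝ), ∀ P P', Box M s P → Box M s P' → ‖P - P'‖ ≤ L * s^5 →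
      ∃ χ, χ * ((1 + s^4) * factor b P') = factor b P ∧ |χ - 1| ≤ 2 * s^4 ∧
        s^4 / 2 ≤ freq b (qA P) - χ * freq b (qA P') ∧
        freq b (qA P) - χ * freq b (qA P') ≤ 2 * s^4 := by
  obtain ⟨C, hC0, hC⟩ := (hasWeight_qA.const_mul (b^2 / 2)).bound M
  filter_upwards [self_mem_nhdsWithin, eventually_const_mul_le (k := 16) one_pos,
    eventually_const_mul_le (k := C) (show (0 : ℝ) < 1 / 16 by norm_num),
    eventually_const_mul_le (k := C * |L|) (show (0 : ℝ) < 1 / 16 by norm_num)]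
    with s hs0 hs1 hs2 hs3 P P' hP hP' hd
  have h0 : 0 < s := hs0
  have h1 : s ≤ 1 := by linarith
  have h2 : C * s^2 ≤ 1 / 16 := by nlinarith [mul_nonneg hC0 h0.le]
  have h3 : |b^2 / 2 * qA P - b^2 / 2 * qA P'| ≤ s^4 / 16 := by
    refine le_of_mul_le_mul_left (((hC s h0 h1 P hP).2 P' hP').trans ?_)
      (show 0 < s^2 by positivity)
    calc _ ≤ C * s^2 * (|L| * s^5) := by
          gcongr
          exact hd.trans (by gcongr; exact le_abs_self L)
      _ = s^6 * (C * |L| * s) := by ring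
      _ ≤ s^6 * (1 / 16) := by gcongr
      _ = _ := by ring
  have h4 : s^4 ≤ 1 / 16 := by
    calc s^4 ≤ s^1 := pow_le_pow_of_le_one h0.le h1 (by norm_num)
      _ ≤ _ := by linarith
  exact frequency_gap (by positivity) h4 ((hC s h0 h1 P hP).1.trans h2)
    ((hC s h0 h1 P' hP').1.trans h2) h3

theorem eventually_deviation_le (b M : ℝ) :
    ∀ᶠ s in 𝓝[>] (0 : ℝ), ∀ P, Box M s P →
      |P.2.2.2.1| + |P.2.2.2.2| ≤ 4 * (|nfXq b P| + |nfZq b P|) := by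
  have hw : HasWeight 3 (fun q => 3 / 2 * (b^2 * (q.2.2.1 * qB q))) :=
    ⟨fun y => 3 / 2 * (b^2 * (y.2.2.2.1 * qB y.2)), by unfold qB; fun_prop,
      fun s q => by simp only [qB, scale]; ring⟩
  obtain ⟨C, hC0, hC⟩ := (hasWeight_qA.const_mul (b^2)).bound M
  obtain ⟨C', hC0', hC'⟩ := hw.bound M
  filter_upwards [self_mem_nhdsWithin, eventually_const_mul_le (k := 1) one_pos,
    eventually_const_mul_le (k := C) (show (0 : ℝ) < 1 / 4 by norm_num),
    eventually_const_mul_le (k := C') (show (0 : ℝ) < 1 / 4 by norm_num)]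
    with s hs0 hs1 hs2 hs3 P hP
  have h0 : 0 < s := hs0
  have h1 : s ≤ 1 := by linarith
  have h2 : |b^2 * qA P| ≤ 1 / 4 := (hC s h0 h1 P hP).1.trans (by
    nlinarith [mul_nonneg hC0 h0.le])
  have h3 : |3 / 2 * (b^2 * (P.2.2.1 * qB P))| ≤ 1 / 4 := (hC' s h0 h1 P hP).1.trans (by
    have : s^3 ≤ s := by simpa using pow_le_pow_of_le_one h0.le h1 (show 1 ≤ 3 by norm_num)
    exact (mul_le_mul_of_nonneg_left this hC0').trans hs3)
  set x := P.2.2.2.1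
  set z := P.2.2.2.2
  set α := b^2 * qA P
  set β := 3 / 2 * (b^2 * (P.2.2.1 * qB P))
  have e1 : nfXq b P = x - 3 / 4 * (α * x) - β * z := by
    simp only [nfXq, lift, nfX, x, z, α, β]
    ring
  have e2 : nfZq b P = z - 1 / 4 * (α * z) := by
    simp only [nfZq, nfZ, z, α]
    ring
  have b1 : |α * x| ≤ 1 / 4 * |x| := by
    rw [abs_mul]
    gcongr
  have b2 : |β * z| ≤ 1 / 4 * |z| := by
    rw [abs_mul]
    gcongr
  have b3 : |α * z| ≤ 1 / 4 * |z| := by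
    rw [abs_mul]
    gcongr
  have c1 : |x| ≤ |nfXq b P| + 3 / 4 * |α * x| + |β * z| := by
    calc |x| = |nfXq b P + 3 / 4 * (α * x) + β * z| := by rw [e1]; congr 1; ring
      _ ≤ _ := by
        refine (abs_add_three _ _ _).trans (le_of_eq ?_)
        rw [abs_mul (3 / 4 : ℝ), abs_of_pos (show (0 : ℝ) < 3 / 4 by norm_num)]
  have c2 : |z| ≤ |nfZq b P| + 1 / 4 * |α * z| := by
    calc |z| = |nfZq b P + 1 / 4 * (α * z)| := by rw [e2]; congr 1; ring
      _ ≤ _ := by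
        refine (abs_add_le _ _).trans (le_of_eq ?_)
        rw [abs_mul (1 / 4 : ℝ), abs_of_pos (show (0 : ℝ) < 1 / 4 by norm_num)]
  linarith [abs_nonneg x, abs_nonneg z, abs_nonneg (nfXq b P), abs_nonneg (nfZq b P)]

theorem exists_local_inverse {E : Type*} [NormedAddCommGroup E] [NormedSpace ℝ E] [CompleteSpace E]
    {Y : E → E} (hY : ContDiff ℝ 1 Y) (h0 : Y 0 = 0)
    (hd : HasFDerivAt Y (ContinuousLinearMap.id ℝ E) 0) :
    ∃ G : E → E, G 0 = 0 ∧ ContDiffAt ℝ 1 G 0 ∧ (∀ᶠ p in 𝓝 0, G (Y p) = p) ∧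
      ∀ᶠ y in 𝓝 0, Y (G y) = y := by
  have hs : HasStrictFDerivAt Y ((ContinuousLinearEquiv.refl ℝ E : E ≃L[ℝ] E) : E →L[ℝ] E) 0 :=
    hY.contDiffAt.hasStrictFDerivAt' hd one_ne_zero
  refine ⟨hs.localInverse Y _ 0, ?_, ?_, hs.eventually_left_inverse, ?_⟩
  · have := hs.localInverse_apply_image
    rwa [h0] at this
  · have := hY.contDiffAt.to_localInverse hs.hasFDerivAt one_ne_zero
    rwa [h0] at this
  · have := hs.eventually_right_inverse
    rwa [h0] at this

section

variable (b : ℝ) (P : State)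

/-- The normal form of the slow variables. -/
noncomputable def nfTriple : ℝ × ℝ × ℝ := (nfU b P, nfV b P, nfWq b P)

/-- The remainder in the normal form of the slow equations. -/
noncomputable def defTriple : ℝ × ℝ × ℝ := (defU b P, defV b P, defW b P)

/-- The velocity of the normal form of the slow variables. -/
noncomputable def drift : ℝ × ℝ × ℝ :=
  (-(factor b P * nfWq b P * nfV b P) + defU b P, factor b P * nfWq b P * nfU b P + defV b P,
    -(factor b P * (nfU b P * nfV b P)) + defW b P)

end

theorem contDiff_nfTriple (b : ℝ) : ContDiff ℝ 1 (nfTriple b) := by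
  unfold nfTriple nfU nfV nfWq qPsi lift nfW psi qA qB
  fun_prop

theorem contDiff_nfXq (b : ℝ) : ContDiff ℝ 1 (nfXq b) := by
  unfold nfXq lift nfX qA qB
  fun_prop

theorem contDiff_nfZq (b : ℝ) : ContDiff ℝ 1 (nfZq b) := by
  unfold nfZq nfZ qA
  fun_prop

theorem hasDerivAt_nfTriple {b t : ℝ} {γ : ℝ → State} (h : HasDerivAt γ (field b (γ t)) t) :
    HasDerivAt (fun t => nfTriple b (γ t)) (drift b (γ t)) t :=
  (hasDerivAt_nfU h).prodMk ((hasDerivAt_nfV h).prodMk (hasDerivAt_nfWq h))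

/-- Scaling covariance of the normal form, up to remainders. -/
theorem smul_drift {b μ χ : ℝ} {P P' : State} (hY : nfTriple b P' = μ • nfTriple b P)
    (hχ : χ * (μ * factor b P') = factor b P) :
    μ • drift b P = χ • drift b P' + (μ • defTriple b P - χ • defTriple b P') := by
  simp only [nfTriple, Prod.smul_mk, smul_eq_mul, Prod.mk.injEq] at hY
  obtain ⟨hU, hV, hW⟩ := hY
  simp only [drift, defTriple, hU, hV, hW, ← hχ, Prod.smul_mk, Prod.mk_add_mk, Prod.mk_sub_mk,
    smul_eq_mul, Prod.mk.injEq]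
  refine ⟨?_, ?_, ?_⟩ <;> ring

theorem hasWeight_nfTriple_sub (b : ℝ) : HasWeight 2 (fun q => nfU b q - q.1) ∧
    HasWeight 2 (fun q => nfV b q - q.2.1) ∧ HasWeight 2 (fun q => nfWq b q - q.2.2.1) := by
  have hp := hasWeight_qPsi b
  refine ⟨?_, ?_, ?_⟩
  · exact ((((hp.mul hasWeight_v).const_mul b).mono (by norm_num)).add
      ((((hp.mul hp).mul hasWeight_u).const_mul (-(b^2 / 2))).mono (by norm_num))).congr
      fun q => by simp only [nfU]; ring
  · exact ((((hp.mul hasWeight_u).const_mul (-b)).mono (by norm_num)).add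
      ((((hp.mul hp).mul hasWeight_v).const_mul (-(b^2 / 2))).mono (by norm_num))).congr
      fun q => by simp only [nfV]; ring
  · exact ⟨fun y => y.1^2 * (b * qA y.2 * y.2.2.2.2.2)
      - y.1^3 * (2 * b * y.2.2.2.1 * qB y.2 * y.2.2.2.2.1), by unfold qA qB; fun_prop,
      fun s q => by simp only [nfWq, lift, nfW, qA, qB, scale]; ring⟩

section

variable {b : ℝ} {hx hz : ℝ × ℝ × ℝ → ℝ}

theorem graph_zero (x0 : hx 0 = 0) (z0 : hz 0 = 0) : graph b hx hz 0 = 0 := by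
  simp [graph, x0, z0, slowX, slowZ, x2, x4, x6, x8, z3, z5, z7]

theorem exists_box_graph (cx : ContDiff ℝ 1 hx) (cz : ContDiff ℝ 1 hz) (z0 : hz 0 = 0)
    (dx0 : fderiv ℝ hx 0 = 0) (dz0 : fderiv ℝ hz 0 = 0)
    (hinv : ∀ᶠ p in 𝓝 (0 : ℝ × ℝ × ℝ), Invariant b hx hz p) :
    ∃ M, ∀ᶠ p in 𝓝 (0 : ℝ × ℝ × ℝ), ∀ s, ‖p‖ ≤ 4 * s → Box M s (graph b hx hz p) := by
  obtain ⟨M, hM, h⟩ := exists_graph_bound cx cz z0 dx0 dz0 hinv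
  refine ⟨16 * M + 4, h.mono fun p hp s hs => ?_⟩
  obtain ⟨h1, h2, h3⟩ := abs_le_norm_triple p
  have hn := norm_nonneg p
  have e1 : ‖p‖ ≤ (16 * M + 4) * s := by nlinarith
  have e2 : M * ‖p‖^2 ≤ (16 * M + 4) * s^2 := by
    calc M * ‖p‖^2 ≤ M * (4 * s)^2 := by gcongr
      _ ≤ _ := by nlinarith [sq_nonneg s]
  exact ⟨h1.trans e1, h2.trans e1, h3.trans e1, hp.1.trans e2, hp.2.trans e2⟩

theorem HasWeight.isBigO_graph {M : ℝ} {n : ℕ} (hn : n ≠ 0) {Q : State → ℝ} (hQ : HasWeight n Q)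
    (x0 : hx 0 = 0) (z0 : hz 0 = 0)
    (h : ∀ᶠ p in 𝓝 (0 : ℝ × ℝ × ℝ), ∀ s, ‖p‖ ≤ 4 * s → Box M s (graph b hx hz p)) :
    (fun p => Q (graph b hx hz p)) =O[𝓝 0] fun p => ‖p‖^n := by
  obtain ⟨C, -, hC⟩ := hQ.bound M
  refine IsBigO.of_bound C ?_
  filter_upwards [h, Metric.ball_mem_nhds 0 one_pos] with p hp hp1
  rcases eq_or_ne p 0 with rfl | h0
  · obtain ⟨P, -, hP⟩ := hQ
    have h0 : Q (0, 0, 0, 0, 0) = 0 := by simpa [scale, hn] using hP 0 0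
    have h0' : Q 0 = 0 := h0
    simp [graph_zero x0 z0, h0', hn]
  · rw [norm_pow, norm_norm, Real.norm_eq_abs]
    exact (hC ‖p‖ (norm_pos_iff.2 h0) (mem_ball_zero_iff.1 hp1).le _
      (hp _ (by linarith [norm_nonneg p]))).1

theorem hasFDerivAt_nfTriple_graph {M : ℝ} (x0 : hx 0 = 0) (z0 : hz 0 = 0)
    (h : ∀ᶠ p in 𝓝 (0 : ℝ × ℝ × ℝ), ∀ s, ‖p‖ ≤ 4 * s → Box M s (graph b hx hz p)) :
    HasFDerivAt (fun p => nfTriple b (graph b hx hz p))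
      (ContinuousLinearMap.id ℝ (ℝ × ℝ × ℝ)) 0 := by
  obtain ⟨h1, h2, h3⟩ := hasWeight_nfTriple_sub b
  have hO : (fun p => nfTriple b (graph b hx hz p) - p) =O[𝓝 0]
      fun p : ℝ × ℝ × ℝ => ‖p - 0‖^2 := by
    simp only [sub_zero]
    exact (h1.isBigO_graph two_ne_zero x0 z0 h).prod_left
      ((h2.isBigO_graph two_ne_zero x0 z0 h).prod_left (h3.isBigO_graph two_ne_zero x0 z0 h))
  have := (hO.hasFDerivAt (𝕜 := ℝ) one_lt_two).add (hasFDerivAt_id (0 : ℝ × ℝ × ℝ))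
  rw [zero_add] at this
  exact this.congr_of_eventuallyEq (.of_forall fun p => by simp)

/-- The evolution of a function along the image of a trajectory under an approximate symmetry. -/
theorem hasDerivAt_comparison (cx : ContDiff ℝ 1 hx) (cz : ContDiff ℝ 1 hz)
    {G : ℝ × ℝ × ℝ → ℝ × ℝ × ℝ} {Q : State → ℝ} (hQ : ContDiff ℝ 1 Q) {d μ χ t : ℝ}
    {p : ℝ → ℝ × ℝ × ℝ} {q : ℝ × ℝ × ℝ} (hp : HasDerivAt p (slowField b hz (p t)) t)
    (hip : Invariant b hx hz (p t)) (hiq : Invariant b hx hz q)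
    (hy : nfTriple b (graph b hx hz q) = μ • nfTriple b (graph b hx hz (p t)))
    (hG : DifferentiableAt ℝ G (μ • nfTriple b (graph b hx hz (p t))))
    (hGq : ∀ᶠ p in 𝓝 q, G (nfTriple b (graph b hx hz p)) = p)
    (hχ : χ * (μ * factor b (graph b hx hz q)) = factor b (graph b hx hz (p t)))
    (hd : fderiv ℝ (fun p => Q (graph b hx hz p)) q (slowField b hz q) = d) :
    HasDerivAt (fun t => Q (graph b hx hz (G (μ • nfTriple b (graph b hx hz (p t))))))
      (χ * d + fderiv ℝ (fun y => Q (graph b hx hz (G y)))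
        (μ • nfTriple b (graph b hx hz (p t)))
        (μ • defTriple b (graph b hx hz (p t)) - χ • defTriple b (graph b hx hz q))) t := by
  have cg := contDiff_graph (b := b) cx cz
  have hQg : Differentiable ℝ fun p => Q (graph b hx hz p) :=
    (hQ.comp cg).differentiable one_ne_zero
  have hYg : Differentiable ℝ fun p => nfTriple b (graph b hx hz p) :=
    ((contDiff_nfTriple b).comp cg).differentiable one_ne_zero
  have cx' := cx.differentiable one_ne_zero
  have cz' := cz.differentiable one_ne_zero
  have hout : DifferentiableAt ℝ (fun y => Q (graph b hx hz (G y)))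
      (μ • nfTriple b (graph b hx hz (p t))) := (hQg _).comp _ hG
  have hin := (hasDerivAt_nfTriple (hasDerivAt_graph cx' cz' hp hip)).const_smul μ
  refine (hout.hasFDerivAt.comp_hasDerivAt t hin).congr_deriv ?_
  set c : ℝ → ℝ × ℝ × ℝ := fun t => q + t • slowField b hz q with hc
  have hc0 : c 0 = q := by simp [hc]
  have hdc : HasDerivAt c (slowField b hz (c 0)) 0 := by
    rw [hc0]
    exact (((hasDerivAt_id (0 : ℝ)).smul_const (slowField b hz q)).const_add q).congr_deriv
      (one_smul ℝ _)
  have hYc := hasDerivAt_nfTriple (hasDerivAt_graph cx' cz' hdc (by rwa [hc0]))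
  have h1 : HasDerivAt (fun t => Q (graph b hx hz (c t))) d 0 := by
    rw [← hd]
    have := (hQg (c 0)).hasFDerivAt.comp_hasDerivAt 0 hdc
    rwa [hc0] at this
  have h2 : HasDerivAt (fun t => Q (graph b hx hz (c t))) (fderiv ℝ
      (fun y => Q (graph b hx hz (G y))) (μ • nfTriple b (graph b hx hz (p t)))
      (drift b (graph b hx hz q))) 0 := by
    rw [← hy] at hout ⊢
    have hout' := hout.hasFDerivAt
    rw [← hc0] at hout' hGq ⊢
    refine (hout'.comp_hasDerivAt 0 hYc).congr_of_eventuallyEq ?_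
    filter_upwards [hdc.continuousAt.eventually hGq] with t ht
    simp only [Function.comp_apply, ht]
  rw [smul_drift hy hχ, map_add, map_smul, h2.unique h1, smul_eq_mul]

end

theorem exists_lipschitz_nhds_zero {E F : Type*} [NormedAddCommGroup E] [NormedSpace ℝ E]
    [NormedAddCommGroup F] [NormedSpace ℝ F] {f : E → F} (hf : ContDiffAt ℝ 1 f 0) :
    ∃ K, 0 ≤ K ∧ ∃ V ∈ 𝓝 (0 : E), (∀ x ∈ V, ∀ y ∈ V, ‖f x - f y‖ ≤ K * ‖x - y‖) ∧
      ∀ x ∈ V, ‖fderiv ℝ f x‖ ≤ K := by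
  obtain ⟨K, t, ht, hK⟩ := hf.exists_lipschitzOnWith
  refine ⟨K, K.2, interior t, interior_mem_nhds.2 ht, fun x hx y hy => ?_, fun x hx => ?_⟩
  · exact hK.norm_sub_le (interior_subset hx) (interior_subset hy)
  · exact norm_fderiv_le_of_lipschitzOn ℝ (mem_interior_iff_mem_nhds.1 hx) hK

/-- Conjugating a dilation close to the identity by a local diffeomorphism. -/
theorem exists_conj_smul_bound {E : Type*} [NormedAddCommGroup E] [NormedSpace ℝ E] {Y G : E → E}
    (cY : ContDiffAt ℝ 1 Y 0) (Y0 : Y 0 = 0) (cG : ContDiffAt ℝ 1 G 0)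
    (hG : ∀ᶠ p in 𝓝 0, G (Y p) = p) :
    ∃ L, 0 ≤ L ∧ ∀ᶠ s in 𝓝[>] (0 : ℝ), ∀ p, ‖p‖ ≤ 3 * s → ‖(1 + s^4) • Y p‖ ≤ L * s ∧
      ‖G ((1 + s^4) • Y p) - p‖ ≤ L * s^5 ∧ ‖G ((1 + s^4) • Y p)‖ ≤ 4 * s := by
  obtain ⟨K, hK, V, hV, hVK, -⟩ := exists_lipschitz_nhds_zero cY
  obtain ⟨K', hK', V', hV', hVK', -⟩ := exists_lipschitz_nhds_zero cG
  refine ⟨K' * (3 * K) + 6 * K, by positivity, ?_⟩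
  filter_upwards [self_mem_nhdsWithin, eventually_const_mul_le (k := 1) one_pos,
    eventually_const_mul_le (k := K' * (3 * K)) one_pos, eventually_forall_norm_le hV 3,
    eventually_forall_norm_le hV' (6 * K), eventually_forall_norm_le hG 3]
    with s hs0 hs1 hs2 h1 h2 h3 p hp
  have h0 : 0 < s := hs0
  have hs1' : s ≤ 1 := by linarith
  have hs4 : s^4 ≤ s := by simpa using pow_le_pow_of_le_one h0.le hs1' (show 1 ≤ 4 by norm_num)
  have hY : ‖Y p‖ ≤ 3 * K * s := by
    have := hVK p (h1 p hp) 0 (mem_of_mem_nhds hV)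
    rw [Y0, sub_zero, sub_zero] at this
    calc ‖Y p‖ ≤ K * ‖p‖ := this
      _ ≤ K * (3 * s) := by gcongr
      _ = _ := by ring
  have hKs : 0 ≤ K * s := by positivity
  have hy : ‖(1 + s^4) • Y p‖ ≤ 6 * K * s := by
    rw [norm_smul, Real.norm_of_nonneg (by positivity)]
    calc (1 + s^4) * ‖Y p‖ ≤ 2 * (3 * K * s) := by gcongr; linarith
      _ = _ := by ring
  have hd : ‖G ((1 + s^4) • Y p) - p‖ ≤ K' * (3 * K) * s^5 := by
    have h4 := hVK' _ (h2 _ hy) (Y p) (h2 _ (by linarith))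
    rw [h3 p hp] at h4
    refine h4.trans ?_
    have h5 : (1 + s^4) • Y p - Y p = s^4 • Y p := by rw [add_smul, one_smul, add_sub_cancel_left]
    rw [h5, norm_smul, Real.norm_of_nonneg (by positivity)]
    calc K' * (s^4 * ‖Y p‖) ≤ K' * (s^4 * (3 * K * s)) := by gcongr
      _ = _ := by ring
  have hKs5 : 0 ≤ K * s^5 := by positivity
  have hK's : 0 ≤ K' * (3 * K) * s := by positivity
  refine ⟨by linarith, by linarith, ?_⟩
  have h6 : K' * (3 * K) * s^5 ≤ s := by
    calc _ = K' * (3 * K) * s * s^4 := by ring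
      _ ≤ 1 * s := by gcongr
      _ = s := one_mul s
  calc _ ≤ ‖G ((1 + s^4) • Y p) - p‖ + ‖p‖ := norm_le_norm_sub_add _ _
    _ ≤ 4 * s := by linarith

section

variable {b : ℝ} {hx hz : ℝ × ℝ × ℝ → ℝ}

/-- The distance to the image under an approximate symmetry, as measured by a phase variable. -/
theorem exists_phase_bound (cx : ContDiff ℝ 1 hx) (cz : ContDiff ℝ 1 hz)
    {Y G : ℝ × ℝ × ℝ → ℝ × ℝ × ℝ} (cG : ContDiffAt ℝ 1 G 0) {L : ℝ} (hL : 0 ≤ L)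
    (h : ∀ᶠ s in 𝓝[>] (0 : ℝ), ∀ p, ‖p‖ ≤ 3 * s → ‖(1 + s^4) • Y p‖ ≤ L * s ∧
      ‖G ((1 + s^4) • Y p) - p‖ ≤ L * s^5 ∧ ‖G ((1 + s^4) • Y p)‖ ≤ 4 * s)
    {F : Type*} [NormedAddCommGroup F] [NormedSpace ℝ F] {Q : State → F} (hQ : ContDiff ℝ 1 Q) :
    ∃ C, 0 ≤ C ∧ ∀ᶠ s in 𝓝[>] (0 : ℝ), ∀ p, ‖p‖ ≤ 3 * s →
      ‖Q (graph b hx hz (G ((1 + s^4) • Y p))) - Q (graph b hx hz p)‖ ≤ C * s^5 ∧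
      ‖fderiv ℝ (fun y => Q (graph b hx hz (G y))) ((1 + s^4) • Y p)‖ ≤ C := by
  have cQ := hQ.comp (contDiff_graph (b := b) cx cz)
  obtain ⟨K, hK, V, hV, hVK, -⟩ := exists_lipschitz_nhds_zero cQ.contDiffAt
  have cQG : ContDiffAt ℝ 1 (fun y => Q (graph b hx hz (G y))) 0 := cQ.contDiffAt.comp 0 cG
  obtain ⟨K', hK', V', hV', -, hVK'⟩ := exists_lipschitz_nhds_zero cQG
  refine ⟨K * L + K', by positivity, ?_⟩
  filter_upwards [self_mem_nhdsWithin, h, eventually_forall_norm_le hV 4,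
    eventually_forall_norm_le hV' L] with s hs0 hs h1 h2 p hp
  have h0 : 0 < s := hs0
  obtain ⟨e1, e2, e3⟩ := hs p hp
  refine ⟨(hVK _ (h1 _ e3) _ (h1 p (by linarith))).trans ?_, (hVK' _ (h2 _ e1)).trans ?_⟩
  · have : 0 ≤ K' * s^5 := by positivity
    calc _ ≤ K * (L * s^5) := by gcongr
      _ ≤ _ := by linarith
  · have : 0 ≤ K * L := by positivity
    linarith

end

section

variable {b : ℝ} {hx hz : ℝ × ℝ × ℝ → ℝ}

/-- The comparison of an oscillation with its image under an approximate symmetry. -/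
theorem exists_oscillation_data (cx : ContDiff ℝ 1 hx) (cz : ContDiff ℝ 1 hz) (x0 : hx 0 = 0)
    (z0 : hz 0 = 0) (dx0 : fderiv ℝ hx 0 = 0) (dz0 : fderiv ℝ hz 0 = 0)
    (hinv : ∀ᶠ p in 𝓝 (0 : ℝ × ℝ × ℝ), Invariant b hx hz p) :
    ∃ Φ : ℝ → ℝ × ℝ × ℝ → ℝ × ℝ × ℝ, ∃ C, 1 ≤ C ∧ ∀ᶠ s in 𝓝[>] (0 : ℝ),
      ∀ (p : ℝ → ℝ × ℝ × ℝ) (t : ℝ), HasDerivAt p (slowField b hz (p t)) t → ‖p t‖ ≤ 3 * s →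
      ∃ ω θ ρ₁ ρ₂ σ₁ σ₂ : ℝ,
        (HasDerivAt (fun t => nfXq b (graph b hx hz (p t)))
          (-(ω * nfZq b (graph b hx hz (p t))) + ρ₁) t ∧
        HasDerivAt (fun t => nfZq b (graph b hx hz (p t)))
          (ω * nfXq b (graph b hx hz (p t)) + ρ₂) t ∧
        HasDerivAt (fun t => nfXq b (graph b hx hz (Φ s (p t))) - nfXq b (graph b hx hz (p t)))
          (-(ω * (nfZq b (graph b hx hz (Φ s (p t))) - nfZq b (graph b hx hz (p t))))
            + θ * nfZq b (graph b hx hz (p t)) + σ₁) t ∧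
        HasDerivAt (fun t => nfZq b (graph b hx hz (Φ s (p t))) - nfZq b (graph b hx hz (p t)))
          (ω * (nfXq b (graph b hx hz (Φ s (p t))) - nfXq b (graph b hx hz (p t)))
            - θ * nfXq b (graph b hx hz (p t)) + σ₂) t) ∧
        s^4 / 2 ≤ θ ∧
        (|nfXq b (graph b hx hz (Φ s (p t))) - nfXq b (graph b hx hz (p t))| ≤ C * s^5 ∧
        |nfZq b (graph b hx hz (Φ s (p t))) - nfZq b (graph b hx hz (p t))| ≤ C * s^5) ∧
        (|σ₁| ≤ C * s^9 ∧ |σ₂| ≤ C * s^9) ∧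
        |ρ₁| ≤ C * (s^9 + s^4 * (|nfXq b (graph b hx hz (p t))|
          + |nfZq b (graph b hx hz (p t))|)) ∧
        |ρ₂| ≤ C * (s^9 + s^4 * (|nfXq b (graph b hx hz (p t))|
          + |nfZq b (graph b hx hz (p t))|)) := by
  have cg := contDiff_graph (b := b) cx cz
  have cY : ContDiff ℝ 1 fun p => nfTriple b (graph b hx hz p) := (contDiff_nfTriple b).comp cg
  obtain ⟨M, hM⟩ := exists_box_graph cx cz z0 dx0 dz0 hinv
  have Y0 : nfTriple b (graph b hx hz 0) = 0 := by
    rw [graph_zero x0 z0]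
    simp [nfTriple, nfU, nfV, nfWq, qPsi, lift, nfW, psi, qA, qB]
  obtain ⟨G, -, cG, hGl, hGr⟩ := exists_local_inverse cY Y0 (hasFDerivAt_nfTriple_graph x0 z0 hM)
  obtain ⟨L, hL, hconj⟩ := exists_conj_smul_bound cY.contDiffAt Y0 cG hGl
  obtain ⟨C₁, hC₁, hX⟩ := exists_phase_bound cx cz cG hL hconj (contDiff_nfXq b)
  obtain ⟨C₂, hC₂, hZ⟩ := exists_phase_bound cx cz cG hL hconj (contDiff_nfZq b)
  obtain ⟨K, -, hK⟩ := exists_phase_bound cx cz cG hL hconj (Q := fun P => P) contDiff_id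
  obtain ⟨CU, hCU, hU⟩ := (hasWeight_defU b).exists_comparison M K
  obtain ⟨CV, hCV, hV⟩ := (hasWeight_defV b).exists_comparison M K
  obtain ⟨CW, hCW, hW⟩ := (hasWeight_defW b).exists_comparison M K
  obtain ⟨CX, hCX, hdX⟩ := (hasWeight_defX b).exists_comparison M K
  obtain ⟨CZ, hCZ, hdZ⟩ := (hasWeight_defZ b).exists_comparison M K
  obtain ⟨BX, hBX, hrX⟩ :=
    (hasWeight_defX b).exists_bound_of_slowPart (hasWeight_defX_slowPart b) M
  obtain ⟨BZ, hBZ, hrZ⟩ :=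
    (hasWeight_defZ b).exists_bound_of_slowPart (hasWeight_defZ_slowPart b) M
  have hdG : ∀ᶠ y in 𝓝 (0 : ℝ × ℝ × ℝ), DifferentiableAt ℝ G y :=
    (cG.eventually (by simp)).mono fun y hy => hy.differentiableAt one_ne_zero
  have hD : 0 ≤ CU + CV + CW := by positivity
  have hD₁ := mul_nonneg hC₁ hD
  have hD₂ := mul_nonneg hC₂ hD
  set D := CU + CV + CW with hDdef
  set C := 1 + 2 * C₁ + 2 * C₂ + CX + CZ + C₁ * D + C₂ * D + 4 * BX + 4 * BZ with hC
  refine ⟨fun s p => G ((1 + s^4) • nfTriple b (graph b hx hz p)), C, by rw [hC]; linarith, ?_⟩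
  filter_upwards [self_mem_nhdsWithin, eventually_const_mul_le (k := 1) one_pos, hconj, hX, hZ, hK,
    eventually_forall_norm_le hM 4, eventually_forall_norm_le hinv 4,
    eventually_forall_norm_le hGl.eventually_nhds 4, eventually_forall_norm_le hGr L,
    eventually_forall_norm_le hdG L, eventually_frequency_gap b M K, eventually_deviation_le b M]
    with s hs0 hs1 hconj hX hZ hK hM hinv hGl hGr hdG hgap hdev p t hp hpt
  have h0 : 0 < s := hs0
  replace hs1 : s ≤ 1 := by linarith
  have hp4 : ‖p t‖ ≤ 4 * s := by linarith
  obtain ⟨hy, -, hq⟩ := hconj _ hpt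
  obtain ⟨hX, hX'⟩ := hX _ hpt
  obtain ⟨hZ, hZ'⟩ := hZ _ hpt
  obtain ⟨hK, -⟩ := hK _ hpt
  have hip := hinv _ hp4
  have hiq := hinv _ hq
  have hbp := hM _ hp4 s hp4
  have hbq := hM _ hq s hq
  have hYq := hGr _ hy
  rw [norm_sub_rev] at hK
  obtain ⟨χ, hχ, hχ1, hgap, hgap'⟩ := hgap _ _ hbp hbq hK
  set y := (1 + s^4) • nfTriple b (graph b hx hz (p t)) with hydef
  set q := G y with hqdef
  set P := graph b hx hz (p t) with hP
  set P' := graph b hx hz q with hP'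
  have hs4 : 0 < s^4 := by positivity
  have hμ : |1 + s^4 - 1| ≤ 2 * s^4 := by
    rw [add_sub_cancel_left, abs_of_pos hs4]
    linarith
  have h1 : |(1 : ℝ) - 1| ≤ 2 * s^4 := by simpa using hs4.le
  have hgr := hasDerivAt_graph (cx.differentiable one_ne_zero)
    (cz.differentiable one_ne_zero) hp hip
  have dX := hasDerivAt_nfXq hgr
  have dZ := hasDerivAt_nfZq hgr
  have dX' := hasDerivAt_comparison cx cz (contDiff_nfXq b) hp hip hiq hYq (hdG _ hy) (hGl _ hq) hχ
    (fderiv_slowField_eq cx cz hiq (contDiff_nfXq b) fun γ hγ h => by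
      have := hasDerivAt_nfXq h
      rwa [hγ] at this)
  have dZ' := hasDerivAt_comparison cx cz (contDiff_nfZq b) hp hip hiq hYq (hdG _ hy) (hGl _ hq) hχ
    (fderiv_slowField_eq cx cz hiq (contDiff_nfZq b) fun γ hγ h => by
      have := hasDerivAt_nfZq h
      rwa [hγ] at this)
  simp only [← hP, ← hP', ← hydef] at dX dZ dX' dZ' hX hZ ⊢
  set R := (1 + s^4) • defTriple b P - χ • defTriple b P' with hR
  set T₁ := fderiv ℝ (fun y => nfXq b (graph b hx hz (G y))) y with hT₁
  set T₂ := fderiv ℝ (fun y => nfZq b (graph b hx hz (G y))) y with hT₂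
  have hs9 : 0 ≤ s^9 := by positivity
  have hRn : ‖R‖ ≤ D * s^9 := by
    have e1 := hU s h0 hs1 P P' hbp hbq hK _ χ hμ hχ1
    have e2 := hV s h0 hs1 P P' hbp hbq hK _ χ hμ hχ1
    have e3 := hW s h0 hs1 P P' hbp hbq hK _ χ hμ hχ1
    have f1 := mul_nonneg hCU hs9
    have f2 := mul_nonneg hCV hs9
    have f3 := mul_nonneg hCW hs9
    refine max_le ?_ (max_le ?_ ?_) <;>
      simp only [R, defTriple, Prod.smul_mk, Prod.mk_sub_mk, smul_eq_mul, Real.norm_eq_abs] <;>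
      linarith
  have hT : ∀ {T : ℝ × ℝ × ℝ →L[ℝ] ℝ} {k : ℝ}, 0 ≤ k → ‖T‖ ≤ k → |T R| ≤ k * D * s^9 :=
    fun {T k} hk hTk => by
      rw [← Real.norm_eq_abs, mul_assoc]
      exact (T.le_opNorm R).trans (by gcongr)
  have hT₁ := hT hC₁ hX'
  have hT₂ := hT hC₂ hZ'
  have hx9 := hdX s h0 hs1 P P' hbp hbq hK 1 χ h1 hχ1
  have hz9 := hdZ s h0 hs1 P P' hbp hbq hK 1 χ h1 hχ1
  rw [one_mul] at hx9 hz9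
  rw [Real.norm_eq_abs] at hX hZ
  set θ := freq b (qA P) - χ * freq b (qA P') with hθ
  have hθ0 : 0 ≤ θ := by linarith
  have hf : ∀ {f k : ℝ}, |f| ≤ k * s^5 → |θ * f| ≤ 2 * k * s^9 := fun {f k} hf => by
    rw [abs_mul, abs_of_nonneg hθ0]
    calc θ * |f| ≤ 2 * s^4 * (k * s^5) := by gcongr
      _ = _ := by ring
  have hfX := hf hX
  have hfZ := hf hZ
  have hρ : ∀ {ρ B : ℝ}, 0 ≤ B → B * 4 ≤ C →
      |ρ| ≤ B * (s^9 + s^4 * (|P.2.2.2.1| + |P.2.2.2.2|)) →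
      |ρ| ≤ C * (s^9 + s^4 * (|nfXq b P| + |nfZq b P|)) := fun {ρ B} hB hBC h => by
    refine h.trans ?_
    calc _ ≤ B * (s^9 + s^4 * (4 * (|nfXq b P| + |nfZq b P|))) := by
          gcongr
          exact hdev P hbp
      _ ≤ B * 4 * (s^9 + s^4 * (|nfXq b P| + |nfZq b P|)) := by linarith [mul_nonneg hB hs9]
      _ ≤ _ := by gcongr
  have hle : ∀ {k : ℝ} {n : ℕ}, k ≤ C → k * s^n ≤ C * s^n := fun hk => by gcongr
  refine ⟨freq b (qA P), θ, defX b P, defZ b P,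
    θ * (nfZq b P' - nfZq b P) - (defX b P - χ * defX b P') + T₁ R,
    -(θ * (nfXq b P' - nfXq b P)) - (defZ b P - χ * defZ b P') + T₂ R, ⟨dX, dZ, ?_, ?_⟩, hgap,
    ⟨hX.trans (hle (by linarith)), hZ.trans (hle (by linarith))⟩, ⟨?_, ?_⟩,
    hρ hBX (by linarith) (hrX s h0 hs1 P hbp), hρ hBZ (by linarith) (hrZ s h0 hs1 P hbp)⟩
  · refine (dX'.fun_sub dX).congr_deriv ?_
    rw [hθ]
    ring
  · refine (dZ'.fun_sub dZ).congr_deriv ?_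
    rw [hθ]
    ring
  · refine le_trans ?_ (hle (show 2 * C₂ + CX + C₁ * D ≤ C by linarith))
    rw [abs_le] at *
    constructor <;> linarith [hfZ.1, hfZ.2, hx9.1, hx9.2, hT₁.1, hT₁.2]
  · refine le_trans ?_ (hle (show 2 * C₁ + CZ + C₂ * D ≤ C by linarith))
    rw [abs_le] at *
    constructor <;> linarith [hfX.1, hfX.2, hz9.1, hz9.2, hT₂.1, hT₂.2]

/-- An invariant graph tangent to the slow variables agrees with the slow expansion up to fifth
order. -/
theorem isBigO_deviation (cx : ContDiff ℝ 1 hx) (cz : ContDiff ℝ 1 hz) (x0 : hx 0 = 0)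
    (z0 : hz 0 = 0) (dx0 : fderiv ℝ hx 0 = 0) (dz0 : fderiv ℝ hz 0 = 0)
    (hinv : ∀ᶠ p in 𝓝 (0 : ℝ × ℝ × ℝ), Invariant b hx hz p) :
    ((fun p => (graph b hx hz p).2.2.2.1) =O[𝓝 0] fun p => ‖p‖^5) ∧
      (fun p => (graph b hx hz p).2.2.2.2) =O[𝓝 0] fun p => ‖p‖^5 := by
  obtain ⟨M, hM⟩ := exists_box_graph cx cz z0 dx0 dz0 hinv
  obtain ⟨Φ, C, hC, hdata⟩ := exists_oscillation_data cx cz x0 z0 dx0 dz0 hinv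
  have key : ∀ᶠ p in 𝓝 (0 : ℝ × ℝ × ℝ), |(graph b hx hz p).2.2.2.1|
      + |(graph b hx hz p).2.2.2.2| ≤ 4 * (576 * C^2) * ‖p‖^5 := by
    have hnorm : Tendsto (fun p : ℝ × ℝ × ℝ => ‖p‖) (𝓝[≠] 0) (𝓝[>] 0) :=
      tendsto_norm_nhdsNE_zero
    have h0 : |(graph b hx hz 0).2.2.2.1| + |(graph b hx hz 0).2.2.2.2|
        ≤ 4 * (576 * C^2) * ‖(0 : ℝ × ℝ × ℝ)‖^5 := by
      simp [graph_zero x0 z0]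
    have hne : ∀ᶠ p in 𝓝[≠] (0 : ℝ × ℝ × ℝ), |(graph b hx hz p).2.2.2.1|
        + |(graph b hx hz p).2.2.2.2| ≤ 4 * (576 * C^2) * ‖p‖^5 := by
      filter_upwards [self_mem_nhdsWithin, nhdsWithin_le_nhds hM, hnorm.eventually hdata,
        hnorm.eventually (eventually_deviation_le b M),
        nhdsWithin_le_nhds (exists_trajectory_slowField cx cz x0 z0 dx0 dz0 hinv)]
        with p₀ hne hM hdata hdev htraj
      have hs : 0 < ‖p₀‖ := norm_pos_iff.2 hne
      set s := ‖p₀‖ with hsdef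
      obtain ⟨p, hp0, hp⟩ := htraj (1 / (6 * C * s^4))
      have H := fun t ht => hdata p t (hp t ht).1 (hp t ht).2
      choose! ω θ ρ₁ ρ₂ σ₁ σ₂ hd hθ hf hσ hρ using H
      have hosc := oscillation_bound hC hs (fun t ht => (hd t ht).1) (fun t ht => (hd t ht).2.1)
        (fun t ht => (hd t ht).2.2.1) (fun t ht => (hd t ht).2.2.2) hθ hf hσ hρ
      rw [hp0] at hosc
      have := hdev _ (hM s (by linarith))
      linarith [hosc.1, hosc.2]
    filter_upwards [eventually_nhdsWithin_iff.1 hne] with p hp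
    rcases eq_or_ne p 0 with rfl | h
    · exact h0
    · exact hp h
  constructor <;> refine IsBigO.of_bound (4 * (576 * C^2)) (key.mono fun p hp => ?_) <;>
    rw [norm_pow, norm_norm, Real.norm_eq_abs]
  · exact (le_add_of_nonneg_right (abs_nonneg _)).trans hp
  · exact (le_add_of_nonneg_left (abs_nonneg _)).trans hp

end

theorem hasFDerivAt_mul_fst_snd (c : ℝ) (p : ℝ × ℝ × ℝ) :
    HasFDerivAt (fun p : ℝ × ℝ × ℝ => c * p.1 * p.2.1)
      ((c * p.2.1) • ContinuousLinearMap.fst ℝ ℝ (ℝ × ℝ) + (c * p.1) •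
        (ContinuousLinearMap.fst ℝ ℝ ℝ).comp (ContinuousLinearMap.snd ℝ ℝ (ℝ × ℝ))) p := by
  have hu : HasFDerivAt (fun p : ℝ × ℝ × ℝ => p.1) _ p := hasFDerivAt_fst (𝕜 := ℝ)
  have hv : HasFDerivAt (fun p : ℝ × ℝ × ℝ => p.2.1) _ p := (hasFDerivAt_snd (𝕜 := ℝ)).fst
  refine ((hu.const_mul c).fun_mul hv).congr_fderiv (ContinuousLinearMap.ext fun x => ?_)
  simp
  ring

theorem hasFDerivAt_mul_sq_sub_sq (c : ℝ) (p : ℝ × ℝ × ℝ) :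
    HasFDerivAt (fun p : ℝ × ℝ × ℝ => c * (p.1 ^ 2 - p.2.1 ^ 2) * p.2.2)
      ((2 * c * p.1 * p.2.2) • ContinuousLinearMap.fst ℝ ℝ (ℝ × ℝ) - (2 * c * p.2.1 * p.2.2) •
        (ContinuousLinearMap.fst ℝ ℝ ℝ).comp (ContinuousLinearMap.snd ℝ ℝ (ℝ × ℝ))
        + (c * (p.1 ^ 2 - p.2.1 ^ 2)) •
          (ContinuousLinearMap.snd ℝ ℝ ℝ).comp (ContinuousLinearMap.snd ℝ ℝ (ℝ × ℝ))) p := by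
  have hu : HasFDerivAt (fun p : ℝ × ℝ × ℝ => p.1) _ p := hasFDerivAt_fst (𝕜 := ℝ)
  have hv : HasFDerivAt (fun p : ℝ × ℝ × ℝ => p.2.1) _ p := (hasFDerivAt_snd (𝕜 := ℝ)).fst
  have hw : HasFDerivAt (fun p : ℝ × ℝ × ℝ => p.2.2) _ p := (hasFDerivAt_snd (𝕜 := ℝ)).snd
  simp only [sq]
  refine ((((hu.fun_mul hu).fun_sub (hv.fun_mul hv)).const_mul c).fun_mul hw).congr_fderiv
    (ContinuousLinearMap.ext fun x => ?_)
  simp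
  ring

theorem isBigO_residual_fst (b : ℝ) :
    (fun p : ℝ × ℝ × ℝ => b ^ 3 * (p.1 ^ 2 - p.2.1 ^ 2) ^ 2 * p.2.2) =O[𝓝 0]
      fun p => ‖p‖ ^ 5 :=
  HasWeight.isBigO (Q := fun q => b ^ 3 * (q.1 ^ 2 - q.2.1 ^ 2) ^ 2 * q.2.2.1) (by norm_num)
    ⟨fun y => b ^ 3 * (y.2.1 ^ 2 - y.2.2.1 ^ 2) ^ 2 * y.2.2.2.1, by fun_prop,
      fun s q => by simp only [scale]; ring⟩

theorem isBigO_residual_snd (b : ℝ) :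
    (fun p : ℝ × ℝ × ℝ => -b * p.1 * p.2.1 * (p.1 ^ 2 - p.2.1 ^ 2)
      - 4 * b * p.1 * p.2.1 * p.2.2 ^ 2
      + 4 * b ^ 3 * p.1 * p.2.1 * (p.1 ^ 2 - p.2.1 ^ 2) * p.2.2 ^ 2) =O[𝓝 0]
      fun p => ‖p‖ ^ 4 :=
  HasWeight.isBigO (Q := fun q => -b * q.1 * q.2.1 * (q.1 ^ 2 - q.2.1 ^ 2)
      - 4 * b * q.1 * q.2.1 * q.2.2.1 ^ 2
      + 4 * b ^ 3 * q.1 * q.2.1 * (q.1 ^ 2 - q.2.1 ^ 2) * q.2.2.1 ^ 2) (by norm_num)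
    ⟨fun y => -b * y.2.1 * y.2.2.1 * (y.2.1 ^ 2 - y.2.2.1 ^ 2)
      - 4 * b * y.2.1 * y.2.2.1 * y.2.2.2.1 ^ 2
      + 4 * b ^ 3 * y.1 ^ 2 * y.2.1 * y.2.2.1 * (y.2.1 ^ 2 - y.2.2.1 ^ 2) * y.2.2.2.1 ^ 2,
      by fun_prop, fun s q => by simp only [scale]; ring⟩

theorem isBigO_norm_pow_succ {E : Type*} [NormedAddCommGroup E] {n : ℕ} :
    (fun p : E => ‖p‖ ^ (n + 1)) =O[𝓝 0] fun p => ‖p‖ ^ n := by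
  refine IsBigO.of_bound 1 ?_
  filter_upwards [Metric.ball_mem_nhds (0 : E) one_pos] with p hp
  have h1 : ‖p‖ ≤ 1 := (mem_ball_zero_iff.1 hp).le
  rw [norm_pow, norm_pow, norm_norm, one_mul]
  exact pow_le_pow_of_le_one (norm_nonneg p) h1 n.le_succ

end LorenzFiveMode

/-- For the Lorenz five-mode system `u̇ = −vw + bvz`, `v̇ = uw − buz`, `ẇ = −uv`,
`ẋ = −z`, `ż = x + buv`, the candidate slow manifold `x = X(u,v,w) = −buv`,
`z = Z(u,v,w) = b(u² − v²)w` satisfies the invariance equations to the stated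
orders: with slow vector field `S = (−vw + bvZ, uw − buZ, −uv)`, the exact
identities `∇X·S + Z = b³(u² − v²)²w` and
`∇Z·S − (X + buv) = −buv(u² − v²) − 4buvw² + 4b³uv(u² − v²)w²` hold; hence the
first residual is `O(s⁵)` and the second is `O(s⁴)`; consequently any exact slow
manifold `(hx, hz)` tangent to the slow modes satisfies `hx = −buv + O(s⁴)` and
`hz = b(u² − v²)w + O(s⁵)`, where `s = ‖(u,v,w)‖`. -/
theorem lorenz_slow_manifold_approximation
    (b : ℝ) (X Z : ℝ × ℝ × ℝ → ℝ) (S : ℝ × ℝ × ℝ → ℝ × ℝ × ℝ)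
    (hX : ∀ p : ℝ × ℝ × ℝ, X p = -b * p.1 * p.2.1)
    (hZ : ∀ p : ℝ × ℝ × ℝ, Z p = b * (p.1 ^ 2 - p.2.1 ^ 2) * p.2.2)
    (hS : ∀ p : ℝ × ℝ × ℝ, S p =
      (-p.2.1 * p.2.2 + b * p.2.1 * Z p,
        p.1 * p.2.2 - b * p.1 * Z p,
        -p.1 * p.2.1)) :
    (∀ p : ℝ × ℝ × ℝ,
      fderiv ℝ X p (S p) + Z p = b ^ 3 * (p.1 ^ 2 - p.2.1 ^ 2) ^ 2 * p.2.2) ∧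
    (∀ p : ℝ × ℝ × ℝ,
      fderiv ℝ Z p (S p) - (X p + b * p.1 * p.2.1)
        = -b * p.1 * p.2.1 * (p.1 ^ 2 - p.2.1 ^ 2)
          - 4 * b * p.1 * p.2.1 * p.2.2 ^ 2
          + 4 * b ^ 3 * p.1 * p.2.1 * (p.1 ^ 2 - p.2.1 ^ 2) * p.2.2 ^ 2) ∧
    ((fun p : ℝ × ℝ × ℝ => fderiv ℝ X p (S p) + Z p)
        =O[𝓝 0] fun p => ‖p‖ ^ 5) ∧
    ((fun p : ℝ × ℝ × ℝ => fderiv ℝ Z p (S p) - (X p + b * p.1 * p.2.1))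
        =O[𝓝 0] fun p => ‖p‖ ^ 4) ∧
    (∀ hx hz : ℝ × ℝ × ℝ → ℝ,
      ContDiff ℝ 1 hx → ContDiff ℝ 1 hz →
      hx 0 = 0 → hz 0 = 0 → fderiv ℝ hx 0 = 0 → fderiv ℝ hz 0 = 0 →
      (∀ᶠ p in 𝓝 (0 : ℝ × ℝ × ℝ),
        fderiv ℝ hx p
            (-p.2.1 * p.2.2 + b * p.2.1 * hz p,
              p.1 * p.2.2 - b * p.1 * hz p,
              -p.1 * p.2.1) = -hz p ∧
        fderiv ℝ hz p
            (-p.2.1 * p.2.2 + b * p.2.1 * hz p,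
              p.1 * p.2.2 - b * p.1 * hz p,
              -p.1 * p.2.1) = hx p + b * p.1 * p.2.1) →
      ((fun p : ℝ × ℝ × ℝ => hx p - X p) =O[𝓝 0] fun p => ‖p‖ ^ 4) ∧
      ((fun p : ℝ × ℝ × ℝ => hz p - Z p) =O[𝓝 0] fun p => ‖p‖ ^ 5)) := by
  have hX' : X = fun p => -b * p.1 * p.2.1 := funext hX
  have hZ' : Z = fun p => b * (p.1 ^ 2 - p.2.1 ^ 2) * p.2.2 := funext hZ
  have h1 : ∀ p : ℝ × ℝ × ℝ,
      fderiv ℝ X p (S p) + Z p = b ^ 3 * (p.1 ^ 2 - p.2.1 ^ 2) ^ 2 * p.2.2 := fun p => by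
    rw [hX', (LorenzFiveMode.hasFDerivAt_mul_fst_snd (-b) p).fderiv, hS, hZ]
    simp
    ring
  have h2 : ∀ p : ℝ × ℝ × ℝ, fderiv ℝ Z p (S p) - (X p + b * p.1 * p.2.1)
      = -b * p.1 * p.2.1 * (p.1 ^ 2 - p.2.1 ^ 2) - 4 * b * p.1 * p.2.1 * p.2.2 ^ 2
        + 4 * b ^ 3 * p.1 * p.2.1 * (p.1 ^ 2 - p.2.1 ^ 2) * p.2.2 ^ 2 := fun p => by
    rw [hX, hS, hZ, hZ', (LorenzFiveMode.hasFDerivAt_mul_sq_sub_sq b p).fderiv]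
    simp
    ring
  refine ⟨h1, h2, ?_, ?_, fun hx hz cx cz x0 z0 dx0 dz0 hinv => ?_⟩
  · simp only [h1]
    exact LorenzFiveMode.isBigO_residual_fst b
  · simp only [h2]
    exact LorenzFiveMode.isBigO_residual_snd b
  · obtain ⟨ex, ez⟩ := LorenzFiveMode.isBigO_deviation (b := b) cx cz x0 z0 dx0 dz0 hinv
    constructor
    · refine ((ex.trans LorenzFiveMode.isBigO_norm_pow_succ).add
        (LorenzFiveMode.isBigO_slowX_tail b)).congr_left fun p => ?_
      simp only [LorenzFiveMode.graph, hX]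
      ring
    · refine (ez.add (LorenzFiveMode.isBigO_slowZ_tail b)).congr_left fun p => ?_
      simp only [LorenzFiveMode.graph, hZ]
      ring
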